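/- arXiv:1610.07092 — 2 statements merged into one kernel-verified Lean document; each statement's English description precedes it below -/
import Mathlib

section
/- There are absolute constants C > 0 and c > 0 such that the following holds. Let G be a finite abelian group and A ⊆ G nonempty with m_G(A+A) ≤ K·m_G(A). Then there exist a symmetric set X ⊆ G with 0 ∈ X and X = −X which has relative polynomial growth of order at most C·log³(2K)·(log(2·log(2K)))³ and satisfies m_G(X) ≥ exp(−C·log³(2K)·(log(2·log(2K)))³)·m_G(A), together with natural numbers m ≥ c·log(2K)·log(2·log(2K)) and r ≤ C·log(2·log(2K)) such that mX ⊆ r(A−A). -/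
open scoped BigOperators Pointwise ENNReal ENat
open Real

namespace Paper

noncomputable section

/-- For `z` on the unit circle, `circNorm z = min {|θ| : z = exp(2πiθ)}`. -/
def circNorm (z : ℂ) : ℝ := |z.arg| / (2 * Real.pi)

variable {G : Type} [AddCommGroup G]

/-- The (generalised) Bohr set with frequency set `Γ` and width function `δ`. -/
def bohrSet (Γ : Set (AddChar G ℂ)) (δ : AddChar G ℂ → ℝ) : Set G :=
  {x | ∀ γ ∈ Γ, circNorm (γ x) < δ γ}

/-- `(Γ, δ)` generates the family of sets `F` as a Bohr system. -/
def IsBohrGen (Γ : Set (AddChar G ℂ)) (δ : AddChar G ℂ → ℝ) (F : ℝ → Set G) : Prop :=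
  (∀ γ ∈ Γ, 0 < δ γ) ∧ ∀ η : ℝ, 0 < η → η ≤ 1 → F η = bohrSet Γ (fun γ => η * δ γ)

/-- A Bohr system: a family `(B_η)_{η ∈ (0,1]}` of subsets of `G` of the form
`B_η = Bohr(Γ, ηδ)` for some generating pair `(Γ, δ)`. -/
structure BohrSystem (G : Type) [AddCommGroup G] where
  sets : ℝ → Set G
  exists_gen : ∃ Γ δ, IsBohrGen Γ δ sets

/-- The covering number `C(S;T) = min {|X| : S ⊆ X + T}`, valued in `ℕ∞`. -/
def coveringNumber {H : Type} [AddCommGroup H] (S T : Set H) : ℕ∞ :=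
  sInf {n : ℕ∞ | ∃ X : Finset H, (X.card : ℕ∞) = n ∧ S ⊆ (X : Set H) + T}

/-- Auxiliary quantity for the difference covering number, for a fixed target group `H`. -/
def dCovAux (S T : Set G) (H : Type) [AddCommGroup H] : ℕ∞ :=
  ⨅ (φ : G →+ H) (U : Set H) (V : Set H) (_ : S ⊆ φ ⁻¹' U) (_ : φ ⁻¹' (V - V) ⊆ T),
    coveringNumber U V

/-- The difference covering number `C^Δ(S;T)`: the infimum of `C_H(U;V)` over all abelian
groups `H`, homomorphisms `φ : G → H` and sets `U, V ⊆ H` with `S ⊆ φ⁻¹(U)` and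
`φ⁻¹(V − V) ⊆ T`. -/
def dCoveringNumber (S T : Set G) : ℕ∞ :=
  ⨅ (H : Type) (inst : AddCommGroup H), @dCovAux G _ S T H inst

/-- Interpret an extended natural number as a real number. -/
def enatReal (n : ℕ∞) : ℝ := (n.toNat : ℝ)

/-- The dimension of a family of sets: `sup {log₂ C^Δ(F_η; F_{η/2}) : η ∈ (0,1]}`. -/
def dimOfSets (F : ℝ → Set G) : ℝ :=
  sSup {r : ℝ | ∃ η : ℝ, 0 < η ∧ η ≤ 1 ∧
    r = Real.logb 2 (enatReal (dCoveringNumber (F η) (F (η / 2))))}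

/-- The dimension `dim B` of a Bohr system. -/
def BohrSystem.dim (B : BohrSystem G) : ℝ := dimOfSets B.sets

/-- The doubling dimension of a family of sets:
`sup {log₂ C(F_η; F_{η/2}) : η ∈ (0,1]}`. -/
def dimStarOfSets (F : ℝ → Set G) : ℝ :=
  sSup {r : ℝ | ∃ η : ℝ, 0 < η ∧ η ≤ 1 ∧
    r = Real.logb 2 (enatReal (coveringNumber (F η) (F (η / 2))))}

/-- The doubling dimension `dim* B` of a Bohr system. -/
def BohrSystem.dimStar (B : BohrSystem G) : ℝ := dimStarOfSets B.sets

/-- `B' ≤ B` for Bohr systems, i.e. `B' ∧ B = B'`, i.e. `B'_η ⊆ B_η` for all `η ∈ (0,1]`. -/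
def BohrSystem.le (B' B : BohrSystem G) : Prop :=
  ∀ η : ℝ, 0 < η → η ≤ 1 → B'.sets η ⊆ B.sets η

/-- The width of a Bohr system: `inf {‖δ‖_{ℓ∞(Γ)} : (Γ,δ) generates B}`. -/
def BohrSystem.width (B : BohrSystem G) : ℝ :=
  sInf {r : ℝ | ∃ Γ δ, IsBohrGen Γ δ B.sets ∧ r = sSup (δ '' Γ)}

/-- The `n`-fold sumset `nS = S + ⋯ + S`. -/
def iterSum : ℕ → Set G → Set G
  | 0, _ => {0}
  | n + 1, S => S + iterSum n S

/-- The set of all cosets of subgroups of `G`. -/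
def cosets (G : Type) [AddCommGroup G] : Set (Set G) :=
  {W | ∃ (H : AddSubgroup G) (x : G), W = (fun h => x + h) '' (H : Set G)}

/-- The set of cosets of a fixed subgroup `H` of `G`. -/
def cosetsOf (H : AddSubgroup G) : Set (Set G) :=
  {W | ∃ x : G, W = (fun h => x + h) '' (H : Set G)}

/-- `f` is `ε`-almost integer-valued, with integer part `fZ`. -/
def AlmostInt (ε : ℝ) (f : G → ℂ) (fZ : G → ℤ) : Prop :=
  ∀ x, ‖f x - (fZ x : ℂ)‖ ≤ ε

/-- The `ρ`-approximate annihilator `N(S,ρ)` of a set `S ⊆ G`. -/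
def annihilator (S : Set G) (ρ : ℝ) : Set (AddChar G ℂ) :=
  {γ | ∀ x ∈ S, ‖(1 : ℂ) - γ x‖ < ρ}

/-- `A` is `(m,l)`-arithmetically connected. -/
def ArithConnected (m l : ℕ) (A : Set G) : Prop :=
  ∀ x : Fin m → G, (∀ i, x i ∈ A) →
    ∃ σ : Fin m → ℤ, (∑ i, (σ i).natAbs) ≤ l ∧
      (∃ i j, i ≠ j ∧ (σ i).natAbs = 1 ∧ (σ j).natAbs = 1) ∧
      (∑ i, σ i • x i) ∈ A

variable [Fintype G]

/-- The Haar probability measure of a subset of the finite group `G`. -/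
def haar (S : Set G) : ℝ := (Nat.card S : ℝ) / (Fintype.card G : ℝ)

/-- A probability measure on the finite group `G`, given by its weight function. -/
def IsProb (w : G → ℝ) : Prop := (∀ x, 0 ≤ w x) ∧ ∑ x, w x = 1

/-- The measure of `S` under the weight function `w`. -/
def wMeasure (w : G → ℝ) (S : Set G) : ℝ := ∑ x, S.indicator w x

/-- The probability measure `μ_S`: `μ` restricted to `S` and normalised. -/
def restrictProb (w : G → ℝ) (S : Set G) : G → ℝ :=
  fun x => S.indicator w x / wMeasure w S

/-- The probability measure `w` is `F`-approximately invariant: for every `η ∈ (0,1]` there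
are probability measures `w⁺, w⁻` with `(1−η)·w⁻ ≤ τ_x(w) ≤ (1+η)·w⁺` for all `x ∈ F η`. -/
def ApproxInvariant (F : ℝ → Set G) (w : G → ℝ) : Prop :=
  ∀ η : ℝ, 0 < η → η ≤ 1 → ∃ wp wm : G → ℝ, IsProb wp ∧ IsProb wm ∧
    ∀ x ∈ F η, ∀ y : G, (1 - η) * wm y ≤ w (y - x) ∧ w (y - x) ≤ (1 + η) * wp y

/-- The Fourier coefficient `f̂(γ) = (1/|G|) ∑_x f(x) conj(γ(x))`. -/
def fourierCoeff (f : G → ℂ) (γ : AddChar G ℂ) : ℂ :=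
  (Fintype.card G : ℂ)⁻¹ * ∑ x, f x * (starRingEnd ℂ) (γ x)

/-- The Wiener norm `‖f‖_{A(G)} = ∑_γ |f̂(γ)|`. -/
def wienerNorm (f : G → ℂ) : ℝ := ∑ᶠ γ : AddChar G ℂ, ‖fourierCoeff f γ‖

/-- The Fourier transform `μ̂(γ) = ∫ conj(γ(x)) dμ(x)` of a measure with weight `w`. -/
def fourierWeight (w : G → ℝ) (γ : AddChar G ℂ) : ℂ :=
  ∑ x, (starRingEnd ℂ) (γ x) * (w x : ℂ)

/-- Convolution `f ∗ μ (x) = ∫ f(x−y) dμ(y)` of a complex function with a measure. -/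
def convC (f : G → ℂ) (w : G → ℝ) (x : G) : ℂ := ∑ y, f (x - y) * (w y : ℂ)

/-- Convolution `f ∗ μ (x) = ∫ f(x−y) dμ(y)` of a real function with a measure. -/
def convR (f : G → ℝ) (w : G → ℝ) (x : G) : ℝ := ∑ y, f (x - y) * w y

/-- Convolution of functions w.r.t. Haar measure: `f ∗ g (x) = (1/|G|) ∑_y f(y) g(x−y)`. -/
def convFun (f g : G → ℝ) (x : G) : ℝ := (Fintype.card G : ℝ)⁻¹ * ∑ y, f y * g (x - y)

/-- The `L_p` norm `(∫ |f|^p dν)^{1/p}` w.r.t. the measure with weight `w`. -/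
def LpW (p : ℝ) (w : G → ℝ) (f : G → ℂ) : ℝ := (∑ y, w y * ‖f y‖ ^ p) ^ (1 / p)

/-- `X` has relative polynomial growth of order `d`. -/
def HasRPG (X : Set G) (d : ℝ) : Prop :=
  ∀ n : ℕ, 1 ≤ n → haar (iterSum n X) ≤ (n : ℝ) ^ d * haar X

end


theorem hoeff1 {G : Type} [DecidableEq G] (S : Finset G) (h : G → ℝ) (k : ℕ) (ε : ℝ)
    (hε : 0 < ε) (hε1 : ε ≤ 1) (hh : ∀ s ∈ S, |h s| ≤ 1) (h0 : ∑ s ∈ S, h s = 0) :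
    (((Fintype.piFinset (fun _ : Fin k => S)).filter
      (fun s => k * ε < ∑ i, h (s i))).card : ℝ) ≤ Real.exp (-(k * ε ^ 2 / 4)) * (S.card : ℝ) ^ k := by
  set F := (Fintype.piFinset (fun _ : Fin k => S)).filter (fun s => k * ε < ∑ i, h (s i)) with hF
  have h1 : (F.card : ℝ) * Real.exp (k * ε ^ 2 / 2) ≤
      ∑ s ∈ Fintype.piFinset (fun _ : Fin k => S), ∏ i, Real.exp (ε / 2 * h (s i)) := by
    calc (F.card : ℝ) * Real.exp (k * ε ^ 2 / 2) = ∑ s ∈ F, Real.exp (k * ε ^ 2 / 2) := by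
          simp
      _ ≤ ∑ s ∈ F, ∏ i, Real.exp (ε / 2 * h (s i)) := by
          apply Finset.sum_le_sum
          intro s hs
          rw [← Real.exp_sum, ← Finset.mul_sum]
          apply Real.exp_le_exp.2
          have := (Finset.mem_filter.1 hs).2
          nlinarith
      _ ≤ _ := by
          apply Finset.sum_le_sum_of_subset_of_nonneg (Finset.filter_subset _ _)
          intros
          positivity
  have h2 : ∑ s ∈ Fintype.piFinset (fun _ : Fin k => S), ∏ i, Real.exp (ε / 2 * h (s i))
      = (∑ s ∈ S, Real.exp (ε / 2 * h s)) ^ k := by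
    rw [Finset.sum_prod_piFinset S (fun _ s => Real.exp (ε / 2 * h s))]
    simp
  have h3 : ∑ s ∈ S, Real.exp (ε / 2 * h s) ≤ S.card * Real.exp (ε ^ 2 / 4) := by
    calc ∑ s ∈ S, Real.exp (ε / 2 * h s) ≤ ∑ s ∈ S, (1 + ε / 2 * h s + ε ^ 2 / 4) := by
          apply Finset.sum_le_sum
          intro s hs
          have ha := hh s hs
          have hb : |ε / 2 * h s| ≤ 1 := by
            rw [abs_mul, abs_of_pos (by positivity)]
            nlinarith [abs_nonneg (h s)]
          have hc := (abs_le.1 (Real.abs_exp_sub_one_sub_id_le hb)).2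
          have hd : (h s) ^ 2 ≤ 1 := by
            rw [← sq_abs]; nlinarith [abs_nonneg (h s)]
          nlinarith [mul_le_mul_of_nonneg_left hd (sq_nonneg ε)]
      _ = S.card * (1 + ε ^ 2 / 4) := by
          rw [Finset.sum_add_distrib, Finset.sum_add_distrib, ← Finset.mul_sum, h0]
          simp; ring
      _ ≤ _ := by
          apply mul_le_mul_of_nonneg_left _ (by positivity)
          have := Real.add_one_le_exp (ε ^ 2 / 4)
          linarith
  have h4 : (F.card : ℝ) * Real.exp (k * ε ^ 2 / 2) ≤ (S.card * Real.exp (ε ^ 2 / 4)) ^ k := by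
    rw [h2] at h1
    refine h1.trans (pow_le_pow_left₀ (by positivity) h3 k)
  rw [mul_pow, ← Real.exp_nat_mul] at h4
  have h5 : Real.exp (-(k * ε ^ 2 / 4)) * (S.card : ℝ) ^ k =
      ((S.card : ℝ) ^ k * Real.exp (k * (ε ^ 2 / 4))) * Real.exp (-(k * ε ^ 2 / 2)) := by
    rw [mul_assoc, ← Real.exp_add, mul_comm]
    congr 2; ring
  rw [h5]
  calc (F.card : ℝ) = (F.card * Real.exp (k * ε ^ 2 / 2)) * Real.exp (-(k * ε ^ 2 / 2)) := by
        rw [mul_assoc, ← Real.exp_add]; simp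
    _ ≤ _ := mul_le_mul_of_nonneg_right h4 (by positivity)

theorem hoeff2 {G : Type} [DecidableEq G] (S : Finset G) (hS : S.Nonempty) (g : G → ℝ) (k : ℕ) (ε : ℝ)
    (hε : 0 < ε) (hε1 : ε ≤ 1) (hg : ∀ s, 0 ≤ g s ∧ g s ≤ 1) :
    (((Fintype.piFinset (fun _ : Fin k => S)).filter
      (fun s => k * ε < |∑ i, g (s i) - k * ((∑ s ∈ S, g s) / S.card)|)).card : ℝ)
      ≤ 2 * Real.exp (-(k * ε ^ 2 / 4)) * (S.card : ℝ) ^ k := by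
  set μ := (∑ s ∈ S, g s) / S.card with hμ
  have hc : (0 : ℝ) < S.card := by exact_mod_cast hS.card_pos
  have hμ0 : 0 ≤ μ := div_nonneg (Finset.sum_nonneg (fun s _ => (hg s).1)) hc.le
  have hμ1 : μ ≤ 1 := by
    rw [hμ, div_le_one hc]
    calc _ ≤ ∑ s ∈ S, (1 : ℝ) := Finset.sum_le_sum (fun s _ => (hg s).2)
      _ = _ := by simp
  have hs0 : ∑ s ∈ S, (g s - μ) = 0 := by
    rw [Finset.sum_sub_distrib]; simp [hμ]; field_simp; simp
  have hb : ∀ s ∈ S, |g s - μ| ≤ 1 := by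
    intro s _; rw [abs_le]; constructor <;> linarith [(hg s).1, (hg s).2]
  have e1 := hoeff1 S (fun s => g s - μ) k ε hε hε1 hb hs0
  have e2 := hoeff1 S (fun s => -(g s - μ)) k ε hε hε1 (by simpa [abs_sub_comm] using hb)
    (by rw [Finset.sum_neg_distrib, hs0, neg_zero])
  have hsub : ((Fintype.piFinset (fun _ : Fin k => S)).filter
      (fun s => k * ε < |∑ i, g (s i) - k * μ|)) ⊆
      ((Fintype.piFinset (fun _ : Fin k => S)).filter (fun s => k * ε < ∑ i, (g (s i) - μ))) ∪
      ((Fintype.piFinset (fun _ : Fin k => S)).filter (fun s => k * ε < ∑ i, -(g (s i) - μ))) := by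
    intro s hs
    rw [Finset.mem_filter] at hs
    rw [Finset.mem_union, Finset.mem_filter, Finset.mem_filter]
    have : ∑ i, (g (s i) - μ) = ∑ i, g (s i) - k * μ := by
      rw [Finset.sum_sub_distrib]; simp
    rw [Finset.sum_neg_distrib, this]
    rcases lt_abs.1 hs.2 with h | h
    · exact Or.inl ⟨hs.1, h⟩
    · exact Or.inr ⟨hs.1, h⟩
  have := (Finset.card_le_card hsub).trans (Finset.card_union_le _ _)
  have h' : (_ : ℝ) ≤ _ := Nat.cast_le (α := ℝ).2 this
  rw [Nat.cast_add] at h'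
  linarith

def lspan {G : Type} [AddCommGroup G] [DecidableEq G] : List G → Finset G
  | [] => {0}
  | a :: l => {0, a} + lspan l

theorem lspan_sub {G : Type} [AddCommGroup G] [DecidableEq G] (X : Finset G) :
    ∀ l : List G, (∀ a ∈ l, a ∈ 3 • X) → (0 : G) ∈ X → lspan l ⊆ (3 * l.length) • X
  | [], _, _ => by simp [lspan]
  | a :: l, h, h0 => by
    have ih := lspan_sub X l (fun b hb => h b (List.mem_cons_of_mem _ hb)) h0
    have ha : ({0, a} : Finset G) ⊆ 3 • X := by
      intro x hx
      rw [Finset.mem_insert, Finset.mem_singleton] at hx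
      rcases hx with rfl | rfl
      · have := Finset.nsmul_mem_nsmul h0 (n := 3)
        simpa using this
      · exact h _ List.mem_cons_self
    rw [lspan, List.length_cons, mul_add, mul_one, add_nsmul, add_comm]
    exact Finset.add_subset_add ih ha |> (fun h => h)

theorem lspan_card {G : Type} [AddCommGroup G] [DecidableEq G] (n : ℕ) :
    ∀ l : List G, (n • (lspan l - lspan l)).card ≤ (2 * n + 1) ^ l.length
  | [] => by simp [lspan]
  | a :: l => by
    have ih := lspan_card n l
    rw [lspan, add_sub_add_comm, nsmul_add, List.length_cons, pow_succ, mul_comm]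
    refine Finset.card_add_le.trans (Nat.mul_le_mul ?_ ih)
    have : n • (({0, a} : Finset G) - {0, a}) ⊆
        (Finset.Icc (-(n : ℤ)) n).image (fun j : ℤ => j • a) := by
      clear ih
      induction n with
      | zero => simp; right; rfl
      | succ n ih =>
        rw [add_nsmul, one_nsmul]
        intro x hx
        obtain ⟨y, hy, z, hz, rfl⟩ := Finset.mem_add.1 hx
        obtain ⟨j, hj, rfl⟩ := Finset.mem_image.1 (ih hy)
        rw [Finset.mem_Icc] at hj
        rw [Finset.mem_image]
        have : z = (0:ℤ) • a ∨ z = (1:ℤ) • a ∨ z = (-1:ℤ) • a := by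
          obtain ⟨u, hu, v, hv, rfl⟩ := Finset.mem_sub.1 hz
          rw [Finset.mem_insert, Finset.mem_singleton] at hu hv
          rcases hu with rfl | rfl <;> rcases hv with rfl | rfl <;> simp
        rcases this with h | h | h
        · exact ⟨j + 0, by rw [Finset.mem_Icc]; push_cast; omega, by rw [h, add_zsmul]⟩
        · exact ⟨j + 1, by rw [Finset.mem_Icc]; push_cast; omega, by rw [h, add_zsmul]⟩
        · exact ⟨j + -1, by rw [Finset.mem_Icc]; push_cast; omega, by rw [h, add_zsmul]⟩
    refine (Finset.card_le_card this).trans (Finset.card_image_le.trans ?_)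
    rw [Int.card_Icc]; omega

theorem chang {G : Type} [AddCommGroup G] [DecidableEq G] (X : Finset G) (h0 : (0 : G) ∈ X)
    (hs : -X = X) (k : ℕ) (hk : ((3 * k + 1) • X).card < 2 ^ k * X.card) (n : ℕ) :
    ((n + 2) • X).card ≤ (2 * n + 1) ^ k * (2 • X).card := by
  have key : ∃ l : List G, l.length ≤ k ∧ 3 • X ⊆ (lspan l - lspan l) + 2 • X := by
    by_contra hcon
    push Not at hcon
    have : ∀ t ≤ k, ∃ l : List G, l.length = t ∧ (∀ a ∈ l, a ∈ 3 • X) ∧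
        (lspan l + X).card = 2 ^ t * X.card := by
      intro t
      induction t with
      | zero => intro _; exact ⟨[], by simp [lspan]⟩
      | succ t ih =>
        intro ht
        obtain ⟨l, hl, hl3, hlc⟩ := ih (by omega)
        obtain ⟨a, ha, hna⟩ := Finset.not_subset.1 (hcon l (by omega))
        refine ⟨a :: l, by simp [hl], ?_, ?_⟩
        · intro b hb
          rcases List.mem_cons.1 hb with rfl | hb
          · exact ha
          · exact hl3 b hb
        · have e : lspan (a :: l) + X = (lspan l + X) ∪ (a +ᵥ (lspan l + X)) := by
            rw [lspan, add_assoc, Finset.insert_eq, Finset.union_add, Finset.singleton_add,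
              Finset.singleton_add]
            congr 1
            simp
          rw [e, Finset.card_union_of_disjoint, Finset.card_vadd_finset, hlc]
          · ring
          · rw [Finset.disjoint_left]
            intro y hy hy'
            apply hna
            obtain ⟨z, hz, rfl⟩ := Finset.mem_vadd_finset.1 hy'
            obtain ⟨p, hp, q, hq, e1⟩ := Finset.mem_add.1 hy
            obtain ⟨p', hp', q', hq', rfl⟩ := Finset.mem_add.1 hz
            rw [Finset.mem_add]
            refine ⟨p - p', Finset.sub_mem_sub hp hp', q - q', ?_, ?_⟩
            · rw [two_nsmul, sub_eq_add_neg]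
              apply Finset.add_mem_add hq
              rw [← hs]; exact Finset.neg_mem_neg hq'
            · rw [vadd_eq_add] at e1
              rw [sub_add_sub_comm, e1]; abel
    obtain ⟨l, hl, hl3, hlc⟩ := this k le_rfl
    have h1 : lspan l + X ⊆ (3 * k + 1) • X := by
      rw [add_nsmul, one_nsmul, ← hl]
      exact Finset.add_subset_add (lspan_sub X l hl3 h0) le_rfl
    have := Finset.card_le_card h1
    omega
  obtain ⟨l, hl, h3⟩ := key
  have hsub : ∀ n : ℕ, (n + 2) • X ⊆ n • (lspan l - lspan l) + 2 • X := by
    intro n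
    induction n with
    | zero => simp
    | succ n ih =>
      calc (n + 1 + 2) • X = (n + 2) • X + X := by rw [← succ_nsmul]
        _ ⊆ n • (lspan l - lspan l) + 2 • X + X := Finset.add_subset_add ih le_rfl
        _ = n • (lspan l - lspan l) + 3 • X := by rw [add_assoc, ← succ_nsmul]
        _ ⊆ n • (lspan l - lspan l) + ((lspan l - lspan l) + 2 • X) :=
          Finset.add_subset_add le_rfl h3
        _ = _ := by rw [← add_assoc, ← succ_nsmul]
  refine (Finset.card_le_card (hsub n)).trans (Finset.card_add_le.trans (Nat.mul_le_mul ?_ le_rfl))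
  exact (lspan_card n l).trans (Nat.pow_le_pow_right (by omega) hl)

theorem cs {G : Type} [AddCommGroup G] [DecidableEq G] [Fintype G] (B S T : Finset G)
    (hB : B.Nonempty) (hS : S.Nonempty) (hT : T.Nonempty) (m k : ℕ) (hm : 1 ≤ m) (κ K2 : ℝ)
    (hK : ((B + S - S).card : ℝ) ≤ K2 * B.card)
    (hκ : ((S + T).card : ℝ) ≤ Real.exp κ * S.card)
    (hk : 64 * (m : ℝ) ^ 2 * Real.log (16 * m * K2) ≤ k) :
    ∃ X : Finset G, (0 : G) ∈ X ∧ -X = X ∧ (T.card : ℝ) * Real.exp (-(κ * k)) / 2 ≤ X.card ∧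
      m • X ⊆ (B - B) + (S - S) := by
  have hBc : (0 : ℝ) < B.card := by exact_mod_cast hB.card_pos
  have hSc : (0 : ℝ) < S.card := by exact_mod_cast hS.card_pos
  have hTc : (0 : ℝ) < T.card := by exact_mod_cast hT.card_pos
  have hm' : (1 : ℝ) ≤ m := by exact_mod_cast hm
  have hK2 : 1 ≤ K2 := by
    have h1 : B.card ≤ (B + S - S).card := by
      obtain ⟨s, hs⟩ := hS
      apply Finset.card_le_card
      intro b hb
      exact Finset.mem_sub.2 ⟨b + s, Finset.add_mem_add hb hs, s, hs, by abel⟩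
    have h2 : (B.card : ℝ) ≤ (B + S - S).card := by exact_mod_cast h1
    by_contra hcon
    push Not at hcon
    nlinarith
  have hbig : 16 ≤ 16 * m * K2 := by nlinarith
  have hlog : 0 < Real.log (16 * m * K2) := Real.log_pos (by linarith)
  have hk0 : (0 : ℝ) < k := lt_of_lt_of_le (by positivity) hk
  set ε : ℝ := 1 / (4 * m) with hε
  have hε0 : 0 < ε := by positivity
  have hε1 : ε ≤ 1 := by rw [hε, div_le_one (by positivity)]; linarith
  set D := B + S with hD
  set g : G → G → ℝ := fun x s => if x + s ∈ D then 1 else 0 with hg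
  have hg01 : ∀ x s, 0 ≤ g x s ∧ g x s ≤ 1 := by
    intro x s; simp only [hg]; split_ifs <;> norm_num
  set f : G → ℝ := fun x => (∑ s ∈ S, g x s) / S.card with hf
  set P := Fintype.piFinset (fun _ : Fin k => S) with hP
  have hPc : (P.card : ℝ) = (S.card : ℝ) ^ k := by simp [hP]
  set bad : (Fin k → G) → Finset G := fun s =>
    Finset.univ.filter (fun x => k * ε < |∑ i, g x (s i) - k * f x|) with hbad
  have hexp : Real.exp (-(k * ε ^ 2 / 4)) ≤ 1 / (16 * m * K2) := by
    rw [Real.exp_neg, one_div]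
    apply inv_anti₀ (by linarith)
    rw [← Real.log_le_iff_le_exp (by linarith)]
    have : (k : ℝ) * ε ^ 2 / 4 = k / (64 * (m : ℝ) ^ 2) := by rw [hε]; field_simp; norm_num
    rw [this, le_div_iff₀ (by positivity)]
    linarith
  have hcount : ∑ s ∈ P, ((bad s).card : ℝ) ≤ B.card / (8 * m) * P.card := by
    have e1 : ∑ s ∈ P, ((bad s).card : ℝ) =
        ∑ x : G, ((P.filter (fun s => k * ε < |∑ i, g x (s i) - k * f x|)).card : ℝ) := by
      simp only [hbad, Finset.card_filter, Nat.cast_sum]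
      rw [Finset.sum_comm]
    have e2 : ∑ x : G, ((P.filter (fun s => k * ε < |∑ i, g x (s i) - k * f x|)).card : ℝ) =
        ∑ x ∈ D - S, ((P.filter (fun s => k * ε < |∑ i, g x (s i) - k * f x|)).card : ℝ) := by
      symm
      apply Finset.sum_subset (Finset.subset_univ _)
      intro x _ hx
      have hx0 : ∀ s ∈ S, g x s = 0 := by
        intro s hs
        simp only [hg]
        rw [if_neg]
        intro h
        exact hx (Finset.mem_sub.2 ⟨x + s, h, s, hs, by abel⟩)
      rw [Nat.cast_eq_zero, Finset.card_eq_zero, Finset.filter_eq_empty_iff]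
      intro s hs
      rw [hP, Fintype.mem_piFinset] at hs
      have h1 : ∑ i, g x (s i) = 0 := Finset.sum_eq_zero (fun i _ => hx0 _ (hs i))
      have h2 : f x = 0 := by
        simp only [hf]; rw [Finset.sum_eq_zero hx0, zero_div]
      rw [h1, h2]
      simp
      positivity
    rw [e1, e2]
    calc _ ≤ ∑ x ∈ D - S, 2 * Real.exp (-(k * ε ^ 2 / 4)) * (S.card : ℝ) ^ k :=
          Finset.sum_le_sum (fun x _ => hoeff2 S hS (g x) k ε hε0 hε1 (hg01 x))
      _ = ((D - S).card : ℝ) * (2 * Real.exp (-(k * ε ^ 2 / 4)) * (S.card : ℝ) ^ k) := by simp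
      _ ≤ (K2 * B.card) * (2 * (1 / (16 * m * K2)) * (S.card : ℝ) ^ k) := by
          gcongr
      _ = _ := by rw [hPc]; field_simp; norm_num
  set L := P.filter (fun s => ((bad s).card : ℝ) ≤ B.card / (4 * m)) with hL
  have hLc : (P.card : ℝ) / 2 ≤ L.card := by
    have h1 : ((P.filter (fun s => ¬ ((bad s).card : ℝ) ≤ B.card / (4 * m))).card : ℝ)
        * (B.card / (4 * m)) ≤ B.card / (8 * m) * P.card := by
      refine le_trans ?_ hcount
      calc _ = ∑ s ∈ P.filter (fun s => ¬ ((bad s).card : ℝ) ≤ B.card / (4 * m)),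
            ((B.card : ℝ) / (4 * m)) := by simp
        _ ≤ ∑ s ∈ P.filter (fun s => ¬ ((bad s).card : ℝ) ≤ B.card / (4 * m)),
            ((bad s).card : ℝ) := by
            apply Finset.sum_le_sum
            intro s hs
            exact (not_le.1 (Finset.mem_filter.1 hs).2).le
        _ ≤ _ := Finset.sum_le_sum_of_subset_of_nonneg (Finset.filter_subset _ _)
            (fun _ _ _ => by positivity)
    have h2 : (L.card : ℝ) + (P.filter (fun s => ¬ ((bad s).card : ℝ) ≤ B.card / (4 * m))).card
        = P.card := by
      have h := Finset.card_filter_add_card_filter_not (s := P)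
        (fun s => ((bad s).card : ℝ) ≤ B.card / (4 * m))
      rw [← Nat.cast_add]
      exact congrArg _ h
    have h3 : (B.card : ℝ) / (8 * m) * P.card = (P.card / 2) * (B.card / (4 * m)) := by
      field_simp; norm_num
    rw [h3] at h1
    have := le_of_mul_le_mul_right h1 (by positivity)
    linarith
  -- pigeonhole
  have hSTne : (S + T).Nonempty := hS.add hT
  have hSTc : (0 : ℝ) < (S + T).card := by exact_mod_cast hSTne.card_pos
  obtain ⟨u, hu, hfib⟩ := Finset.exists_le_card_fiber_of_nsmul_le_card_of_maps_to
    (s := T ×ˢ L) (t := Fintype.piFinset (fun _ : Fin k => S + T))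
    (f := fun q => fun i => q.2 i + q.1)
    (b := (T.card : ℝ) * L.card / ((S + T).card : ℝ) ^ k)
    (by
      intro q hq
      rw [Finset.mem_product] at hq
      have := (Finset.mem_filter.1 hq.2).1
      rw [hP, Fintype.mem_piFinset] at this
      rw [Fintype.mem_piFinset]
      intro i
      exact Finset.add_mem_add (this i) hq.1)
    (by
      obtain ⟨y, hy⟩ := hSTne
      exact ⟨fun _ => y, by simp [hy]⟩)
    (by
      rw [Fintype.card_piFinset, Finset.card_product]
      simp only [Finset.prod_const, Finset.card_univ, Fintype.card_fin, nsmul_eq_mul]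
      push_cast
      rw [mul_div_cancel₀]
      positivity)
  set T' := T.filter (fun t => (fun i => u i - t) ∈ L) with hT'
  have hT'c : (T.card : ℝ) * L.card / ((S + T).card : ℝ) ^ k ≤ T'.card := by
    refine hfib.trans ?_
    norm_cast
    apply Finset.card_le_card_of_injOn Prod.fst
    · intro q hq
      have hq := Finset.mem_filter.1 (Finset.mem_coe.1 hq)
      have hq1 := Finset.mem_product.1 hq.1
      refine Finset.mem_coe.2 (Finset.mem_filter.2 ⟨hq1.1, ?_⟩)
      have : (fun i => u i - q.1) = q.2 := by
        rw [← hq.2]; funext i; simp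
      rw [this]; exact hq1.2
    · intro q hq q' hq' h
      have hq := (Finset.mem_filter.1 (Finset.mem_coe.1 hq)).2
      have hq' := (Finset.mem_filter.1 (Finset.mem_coe.1 hq')).2
      refine Prod.ext h ?_
      funext i
      have := congrFun (hq.trans hq'.symm) i
      simp only [h] at this
      exact add_right_cancel this
  have hT'big : (T.card : ℝ) * Real.exp (-(κ * k)) / 2 ≤ T'.card := by
    refine le_trans ?_ hT'c
    rw [le_div_iff₀ (by positivity)]
    have h1 : ((S + T).card : ℝ) ^ k ≤ Real.exp (κ * k) * P.card := by
      rw [hPc]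
      calc _ ≤ (Real.exp κ * S.card) ^ k := pow_le_pow_left₀ (by positivity) hκ k
        _ = _ := by rw [mul_pow, ← Real.exp_nat_mul, mul_comm κ]
    calc (T.card : ℝ) * Real.exp (-(κ * k)) / 2 * ((S + T).card : ℝ) ^ k
        ≤ (T.card : ℝ) * Real.exp (-(κ * k)) / 2 * (Real.exp (κ * k) * P.card) := by gcongr
      _ = T.card * (P.card / 2) * (Real.exp (-(κ * k)) * Real.exp (κ * k)) := by ring
      _ = T.card * (P.card / 2) := by rw [← Real.exp_add]; simp
      _ ≤ _ := by gcongr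
  have hT'pos : (0 : ℝ) < T'.card := lt_of_lt_of_le (by positivity) hT'big
  have hT'ne : T'.Nonempty := Finset.card_pos.1 (by exact_mod_cast hT'pos)
  have hshift : ∀ (z : G) (Q : G → Prop) [DecidablePred Q],
      (Finset.univ.filter (fun x => Q (x + z))).card ≤ (Finset.univ.filter Q).card := by
    intro z Q _
    apply Finset.card_le_card_of_injOn (fun x => x + z)
    · intro x hx
      simpa using hx
    · intro x _ y _ h
      exact add_right_cancel h
  have hX : ∀ z ∈ T' - T',
      ((Finset.univ.filter (fun x => 2 * ε < |f (x + z) - f x|)).card : ℝ) ≤ B.card / (2 * m) := by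
    intro z hz
    obtain ⟨t, ht, t', ht', rfl⟩ := Finset.mem_sub.1 hz
    have b1 := (Finset.mem_filter.1 (Finset.mem_filter.1 ht).2).2
    have b2 := (Finset.mem_filter.1 (Finset.mem_filter.1 ht').2).2
    have hsub : Finset.univ.filter (fun x => 2 * ε < |f (x + (t - t')) - f x|) ⊆
        Finset.univ.filter (fun x => k * ε <
          |∑ i, g (x + (t - t')) (u i - t) - k * f (x + (t - t'))|) ∪ bad (fun i => u i - t') := by
      intro x hx
      rw [Finset.mem_filter] at hx
      by_contra hcon
      rw [Finset.mem_union, Finset.mem_filter] at hcon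
      push Not at hcon
      obtain ⟨c1, c2⟩ := hcon
      have c1 := c1 (Finset.mem_univ _)
      have c2 : |∑ i, g x (u i - t') - k * f x| ≤ k * ε := by
        by_contra h
        exact c2 (Finset.mem_filter.2 ⟨Finset.mem_univ _, not_le.1 h⟩)
      have e : ∑ i, g (x + (t - t')) (u i - t) = ∑ i, g x (u i - t') := by
        apply Finset.sum_congr rfl
        intro i _
        simp only [hg]
        rw [show x + (t - t') + (u i - t) = x + (u i - t') by abel]
      rw [e] at c1
      have h3 : |(k : ℝ) * (f (x + (t - t')) - f x)| ≤ k * (2 * ε) := by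
        rw [abs_le] at c1 c2 ⊢
        constructor <;> linarith [c1.1, c1.2, c2.1, c2.2]
      rw [abs_mul, abs_of_pos hk0] at h3
      have := le_of_mul_le_mul_left h3 hk0
      linarith [hx.2]
    have h1 := (Finset.card_le_card hsub).trans (Finset.card_union_le _ _)
    have h2 := hshift (t - t') (fun x => k * ε < |∑ i, g x (u i - t) - k * f x|)
    have h3 : ((Finset.univ.filter (fun x => 2 * ε < |f (x + (t - t')) - f x|)).card : ℝ) ≤
        (bad (fun i => u i - t)).card + (bad (fun i => u i - t')).card := by
      exact_mod_cast h1.trans (Nat.add_le_add_right h2 _)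
    have h4 : (B.card : ℝ) / (2 * m) = B.card / (4 * m) + B.card / (4 * m) := by
      field_simp; norm_num
    linarith
  have hmX : ∀ (j : ℕ), ∀ z ∈ j • (T' - T'),
      ((Finset.univ.filter (fun x => j * (2 * ε) < |f (x + z) - f x|)).card : ℝ)
        ≤ j * (B.card / (2 * m)) := by
    intro j
    induction j with
    | zero =>
      intro z hz
      rw [zero_nsmul, Finset.mem_zero] at hz
      simp [hz]
    | succ j ih =>
      intro z hz
      rw [succ_nsmul] at hz
      obtain ⟨w, hw, y, hy, rfl⟩ := Finset.mem_add.1 hz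
      have hsub : Finset.univ.filter (fun x => ((j + 1 : ℕ) : ℝ) * (2 * ε) < |f (x + (w + y)) - f x|) ⊆
        Finset.univ.filter (fun x => 2 * ε < |f (x + w + y) - f (x + w)|) ∪
        Finset.univ.filter (fun x => j * (2 * ε) < |f (x + w) - f x|) := by
        intro x hx
        rw [Finset.mem_filter] at hx
        by_contra hcon
        rw [Finset.mem_union, Finset.mem_filter, Finset.mem_filter] at hcon
        push Not at hcon
        have c1 := hcon.1 (Finset.mem_univ _)
        have c2 := hcon.2 (Finset.mem_univ _)
        have h := hx.2
        rw [← add_assoc] at h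
        push_cast at h
        have := abs_sub_le (f (x + w + y)) (f (x + w)) (f x)
        linarith
      have h1 := (Finset.card_le_card hsub).trans (Finset.card_union_le _ _)
      have h2 := hshift w (fun x => 2 * ε < |f (x + y) - f x|)
      have h3 : ((Finset.univ.filter
          (fun x => ((j + 1 : ℕ) : ℝ) * (2 * ε) < |f (x + (w + y)) - f x|)).card : ℝ) ≤
          (Finset.univ.filter (fun x => 2 * ε < |f (x + y) - f x|)).card +
          (Finset.univ.filter (fun x => j * (2 * ε) < |f (x + w) - f x|)).card := by
        exact_mod_cast h1.trans (Nat.add_le_add_right h2 _)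
      have h4 := hX y hy
      have h5 := ih w hw
      push_cast at h3 ⊢
      linarith
  refine ⟨T' - T', ?_, neg_sub _ _, ?_, ?_⟩
  · obtain ⟨t, ht⟩ := hT'ne
    exact Finset.mem_sub.2 ⟨t, ht, t, ht, sub_self t⟩
  · refine hT'big.trans ?_
    obtain ⟨t, ht⟩ := hT'ne
    norm_cast
    apply Finset.card_le_card_of_injOn (fun x => x - t)
    · intro x hx
      exact Finset.mem_coe.2 (Finset.sub_mem_sub (Finset.mem_coe.1 hx) ht)
    · intro x _ y _ h
      exact sub_left_injective h
  · intro z hz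
    have h1 := hmX m z hz
    have h2 : (m : ℝ) * (B.card / (2 * m)) = B.card / 2 := by field_simp
    have h3 : (m : ℝ) * (2 * ε) = 1 / 2 := by rw [hε]; field_simp; norm_num
    rw [h2, h3] at h1
    have : ∃ x ∈ B, ¬ (1 / 2 < |f (x + z) - f x|) := by
      by_contra hcon
      push Not at hcon
      have : B ⊆ Finset.univ.filter (fun x => 1 / 2 < |f (x + z) - f x|) := by
        intro x hx
        exact Finset.mem_filter.2 ⟨Finset.mem_univ _, hcon x hx⟩
      have h4 : (B.card : ℝ) ≤
          (Finset.univ.filter (fun x => 1 / 2 < |f (x + z) - f x|)).card := by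
        exact_mod_cast Finset.card_le_card this
      linarith
    obtain ⟨x, hx, hxx⟩ := this
    have hfx : f x = 1 := by
      simp only [hf]
      rw [div_eq_one_iff_eq hSc.ne']
      rw [Finset.sum_congr rfl (g := fun _ => (1 : ℝ))]
      · simp
      · intro s hs
        simp only [hg]
        rw [if_pos (Finset.add_mem_add hx hs)]
    have hpos : 0 < f (x + z) := by
      rw [not_lt, hfx, abs_le] at hxx
      linarith [hxx.1]
    have : ∃ s ∈ S, x + z + s ∈ D := by
      by_contra hcon
      push Not at hcon
      have : f (x + z) = 0 := by
        simp only [hf]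
        rw [Finset.sum_eq_zero, zero_div]
        intro s hs
        simp only [hg]
        rw [if_neg (hcon s hs)]
      linarith
    obtain ⟨s, hs, hd⟩ := this
    obtain ⟨b, hb, s', hs', e⟩ := Finset.mem_add.1 hd
    refine Finset.mem_add.2 ⟨b - x, Finset.sub_mem_sub hb hx, s' - s, Finset.sub_mem_sub hs' hs, ?_⟩
    have : z = (x + z + s) - x - s := by abel
    rw [this, ← e]; abel

theorem alg0 {M : Type} [AddCommMonoid M] (A N : M) (r : ℕ) :
    (A + r • (A + N)) + (N + r • (N + A)) = (2 * r + 1) • (A + N) := by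
  simp only [add_nsmul, one_nsmul, two_mul, nsmul_add]
  abel

theorem neg_alg {M : Type} [SubtractionCommMonoid M] (A : M) (r : ℕ) :
    (A + r • (A - A)) - (A + r • (A - A)) = (2 * r + 1) • (A + -A) := by
  rw [← alg0, sub_eq_add_neg _ (A + _), neg_add, ← neg_nsmul, neg_sub, sub_eq_add_neg,
    add_comm (-A) A]

theorem alg1 {M : Type} [SubtractionCommMonoid M] (A : M) (r : ℕ) :
    A + (A + r • (A - A)) - (A + r • (A - A)) = (2 * r + 2) • A - (2 * r + 1) • A := by
  rw [add_sub_assoc, neg_alg, nsmul_add, neg_nsmul, ← add_assoc, ← sub_eq_add_neg, ← succ_nsmul']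

theorem alg2 {M : Type} [SubtractionCommMonoid M] (A : M) (r : ℕ) :
    (A - A) + ((A + r • (A - A)) - (A + r • (A - A))) = (2 * r + 2) • (A - A) := by
  rw [neg_alg, ← sub_eq_add_neg, ← succ_nsmul']

theorem plun {G : Type} [AddCommGroup G] [DecidableEq G] (A : Finset G) (hA : A.Nonempty) (K : ℝ)
    (hK : ((A + A).card : ℝ) ≤ K * A.card) (a b : ℕ) :
    ((a • A - b • A).card : ℝ) ≤ K ^ (a + b) * A.card := by
  have hc : (0 : ℝ) < A.card := by exact_mod_cast hA.card_pos
  have h := Finset.pluennecke_ruzsa_inequality_nsmul_sub_nsmul_add hA A a b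
  have h' : ((a • A - b • A).card : ℝ) ≤ ((A + A).card / A.card : ℝ) ^ (a + b) * A.card := by
    have h2 := (NNRat.cast_le (K := ℝ)).2 h
    push_cast at h2
    exact h2
  refine h'.trans ?_
  gcongr
  rwa [div_le_iff₀ hc]

theorem nsmul_mono_left {G : Type} [AddCommGroup G] [DecidableEq G] (X : Finset G)
    (h0 : (0 : G) ∈ X) {a b : ℕ} (h : a ≤ b) : a • X ⊆ b • X := by
  obtain ⟨c, rfl⟩ := Nat.exists_eq_add_of_le h
  rw [add_nsmul]
  intro x hx
  have := Finset.nsmul_mem_nsmul h0 (n := c)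
  rw [nsmul_zero] at this
  exact Finset.mem_add.2 ⟨x, hx, 0, this, add_zero x⟩

theorem nsmul_mono_right {G : Type} [AddCommGroup G] [DecidableEq G] {X Y : Finset G}
    (h : X ⊆ Y) (a : ℕ) : a • X ⊆ a • Y := by
  induction a with
  | zero => simp
  | succ a ih => rw [succ_nsmul, succ_nsmul]; exact Finset.add_subset_add ih h

theorem step {G : Type} [AddCommGroup G] [DecidableEq G] [Fintype G] (A : Finset G)
    (hA : A.Nonempty) (K L Λ : ℝ) (hK1 : 1 ≤ K) (hL : Real.log K ≤ L)
    (hK : ((A + A).card : ℝ) ≤ K * A.card) (X : Finset G) (h0 : (0 : G) ∈ X)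
    (m r m' : ℕ) (hm : 1 ≤ m) (hm' : 1 ≤ m')
    (hX : m • X ⊆ r • (A - A)) (hΛ : Real.log (16 * m' * K ^ (4 * r + 3)) ≤ Λ) :
    ∃ X' : Finset G, (0 : G) ∈ X' ∧ -X' = X' ∧
      (X.card : ℝ) * Real.exp (-((2 * r + 1) * L / m * (64 * m' ^ 2 * Λ + 1))) / 2 ≤ X'.card ∧
      m' • X' ⊆ (2 * r + 2) • (A - A) := by
  have hc : (0 : ℝ) < A.card := by exact_mod_cast hA.card_pos
  have hL0 : 0 ≤ L := (Real.log_nonneg hK1).trans hL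
  have hm0 : (0 : ℝ) < m := by exact_mod_cast hm
  have hKL : ∀ n : ℕ, K ^ n ≤ Real.exp (n * L) := by
    intro n
    rw [Real.exp_nat_mul]
    apply pow_le_pow_left₀ (by linarith)
    rwa [← Real.log_le_iff_le_exp (by linarith)]
  set κ : ℝ := (2 * r + 1) * L / m with hκ
  have hκ0 : 0 ≤ κ := by positivity
  set U := A + r • (A - A) with hU
  have hUeq : U = (r + 1) • A - r • A := by
    rw [hU, nsmul_sub, add_nsmul, one_nsmul, add_sub_assoc', add_comm A]
  have hUc : (U.card : ℝ) ≤ Real.exp ((2 * r + 1) * L) * A.card := by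
    rw [hUeq]
    refine (plun A hA K hK _ _).trans ?_
    have := hKL (r + 1 + r)
    push_cast at this
    rw [show (r : ℝ) + 1 + r = 2 * r + 1 by ring] at this
    gcongr
  have hSU : ∀ j ≤ m, A + j • X ⊆ U := fun j hj =>
    Finset.add_subset_add le_rfl ((nsmul_mono_left X h0 hj).trans hX)
  have hj : ∃ j < m, ((A + (j + 1) • X).card : ℝ) ≤ Real.exp κ * (A + j • X).card := by
    by_contra hcon
    push Not at hcon
    have h1 : ∀ j ≤ m, Real.exp (j * κ) * A.card ≤ (A + j • X).card := by
      intro j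
      induction j with
      | zero => intro _; simp
      | succ j ih =>
        intro hjm
        have a1 := ih (by omega)
        have a2 := hcon j (by omega)
        refine le_trans ?_ a2.le
        push_cast
        rw [add_mul, one_mul, Real.exp_add, mul_comm (Real.exp _), mul_assoc]
        gcongr
    obtain ⟨m0, rfl⟩ := Nat.exists_eq_add_of_le' hm
    have a1 := h1 m0 (by omega)
    have a2 := hcon m0 (by omega)
    have a3 : ((A + (m0 + 1) • X).card : ℝ) ≤ U.card := by
      exact_mod_cast Finset.card_le_card (hSU (m0 + 1) le_rfl)
    have a4 : Real.exp κ * (Real.exp (m0 * κ) * A.card) ≤ Real.exp κ * (A + m0 • X).card := by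
      gcongr
    have a5 : Real.exp κ * (Real.exp (m0 * κ) * A.card) = Real.exp ((2 * r + 1) * L) * A.card := by
      rw [← mul_assoc, ← Real.exp_add]
      congr 2
      have : ((m0 + 1 : ℕ) : ℝ) * κ = (2 * r + 1) * L := by rw [hκ]; field_simp
      rw [← this]; push_cast; ring
    linarith
  obtain ⟨j, hjm, hj⟩ := hj
  have hS := hSU j hjm.le
  have hB : ((A + (A + j • X) - (A + j • X)).card : ℝ) ≤ K ^ (4 * r + 3) * A.card := by
    have h1 : A + (A + j • X) - (A + j • X) ⊆ (2 * r + 2) • A - (2 * r + 1) • A := by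
      refine (Finset.sub_subset_sub (Finset.add_subset_add le_rfl hS) hS).trans (le_of_eq ?_)
      rw [hU]; exact alg1 A r
    have h2 := plun A hA K hK (2 * r + 2) (2 * r + 1)
    have h3 : ((A + (A + j • X) - (A + j • X)).card : ℝ) ≤
        ((2 * r + 2) • A - (2 * r + 1) • A).card := by exact_mod_cast Finset.card_le_card h1
    refine h3.trans (h2.trans (le_of_eq ?_))
    congr 2; ring
  have hΛ0 : 0 ≤ Λ := by
    refine le_trans (Real.log_nonneg ?_) hΛ
    have h1 : (1 : ℝ) ≤ m' := by exact_mod_cast hm'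
    have h2 : 1 ≤ K ^ (4 * r + 3) := one_le_pow₀ hK1
    nlinarith
  obtain ⟨X', c1, c2, c3, c4⟩ := cs A (A + j • X) X hA (hA.add (Finset.Nonempty.nsmul ⟨0, h0⟩ ))
    ⟨0, h0⟩ m' ⌈64 * (m' : ℝ) ^ 2 * Λ⌉₊ hm' κ (K ^ (4 * r + 3)) hB
    (by rw [add_assoc, ← succ_nsmul]; exact hj)
    ((mul_le_mul_of_nonneg_left hΛ (by positivity)).trans (Nat.le_ceil _))
  refine ⟨X', c1, c2, le_trans ?_ c3, c4.trans ?_⟩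
  · have := (Nat.ceil_lt_add_one (a := 64 * (m' : ℝ) ^ 2 * Λ) (by positivity)).le
    gcongr
  · refine (Finset.add_subset_add le_rfl (Finset.sub_subset_sub hS hS)).trans (le_of_eq ?_)
    rw [hU]; exact alg2 A r

theorem iter {G : Type} [AddCommGroup G] [DecidableEq G] [Fintype G] (A : Finset G)
    (hA : A.Nonempty) (K L D : ℝ) (N : ℕ) (hK1 : 1 ≤ K) (hL : Real.log K ≤ L)
    (hL2 : Real.log 2 ≤ L) (hN : 1 ≤ N) (hD0 : 0 ≤ D) (hD : Real.log (4 * N) ≤ D * L)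
    (hK : ((A + A).card : ℝ) ≤ K * A.card) (i : ℕ) :
    ∃ (X : Finset G) (m r : ℕ), (0 : G) ∈ X ∧ -X = X ∧ 1 ≤ m ∧ m ≤ 4 * N ∧ r + 2 = 3 * 2 ^ i ∧
      N ^ 2 ^ i ≤ N * m ^ 2 ^ i ∧ m • X ⊆ r • (A - A) ∧
      (A.card : ℝ) * Real.exp (-(3 * (780 * (11 + D) + 4) * 4 ^ i * L ^ 2 * N)) ≤ X.card := by
  have hc : (0 : ℝ) < A.card := by exact_mod_cast hA.card_pos
  have hl2 := Real.log_two_gt_d9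
  have hl2' := Real.log_two_lt_d9
  have hLh : 1 / 2 ≤ L := by linarith
  have hN' : (1 : ℝ) ≤ N := by exact_mod_cast hN
  induction i with
  | zero =>
    refine ⟨A - A, 1, 1, ?_, neg_sub _ _, le_rfl, by omega, by norm_num, by simp, le_rfl, ?_⟩
    · obtain ⟨t, ht⟩ := hA
      exact Finset.mem_sub.2 ⟨t, ht, t, ht, sub_self t⟩
    · have h1 : (A.card : ℝ) ≤ (A - A).card := by
        obtain ⟨t, ht⟩ := hA
        norm_cast
        apply Finset.card_le_card_of_injOn (fun x => x - t)
        · intro x hx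
          exact Finset.mem_coe.2 (Finset.sub_mem_sub (Finset.mem_coe.1 hx) ht)
        · intro x _ y _ h
          exact sub_left_injective h
      refine le_trans ?_ h1
      apply mul_le_of_le_one_right hc.le
      rw [Real.exp_le_one_iff, neg_nonpos]
      positivity
  | succ i ih =>
    obtain ⟨X, m, r, h0, hs, hm, hm4, hr, hNm, hX, hXc⟩ := ih
    have hr1 : 1 ≤ r := by
      have : 1 ≤ 2 ^ i := Nat.one_le_two_pow
      omega
    set m' := Nat.sqrt (N * m) + 1 with hm'
    have hNm1 : 1 ≤ N * m := Nat.mul_pos hN hm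
    have hs1 : 1 ≤ Nat.sqrt (N * m) := Nat.sqrt_pos.2 hNm1
    have hlow : N * m ≤ m' ^ 2 := (Nat.lt_succ_sqrt' (N * m)).le
    have hup : m' ^ 2 ≤ 4 * (N * m) := by
      have := Nat.sqrt_le' (N * m)
      rw [hm']; nlinarith
    have hm'4 : m' ≤ 4 * N := by
      by_contra h
      push Not at h
      nlinarith
    have hm'1 : 1 ≤ m' := by omega
    have hr1' : (1 : ℝ) ≤ r := by exact_mod_cast hr1
    have hm0 : (1 : ℝ) ≤ m := by exact_mod_cast hm
    have hm'0 : (1 : ℝ) ≤ m' := by exact_mod_cast hm'1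
    have hΛ : Real.log (16 * m' * K ^ (4 * r + 3)) ≤ (11 + D) * r * L := by
      rw [Real.log_mul (by positivity) (by positivity), Real.log_mul (by positivity) (by positivity),
        Real.log_pow]
      have e1 : Real.log 16 ≤ 4 * L := by
        rw [show (16 : ℝ) = 2 ^ 4 by norm_num, Real.log_pow]
        push_cast; linarith
      have e2 : Real.log m' ≤ D * L := by
        refine le_trans (Real.log_le_log (by positivity) ?_) hD
        exact_mod_cast hm'4
      have e3 : ((4 * r + 3 : ℕ) : ℝ) * Real.log K ≤ (4 * r + 3) * L := by
        push_cast; gcongr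
      have e4 : L ≤ r * L := by nlinarith
      have e5 : D * L ≤ D * (r * L) := by gcongr
      nlinarith
    obtain ⟨X', c1, c2, c3, c4⟩ := step A hA K L ((11 + D) * r * L) hK1 hL hK X h0 m r m' hm hm'1 hX hΛ
    refine ⟨X', m', 2 * r + 2, c1, c2, hm'1, hm'4, ?_, ?_, c4, ?_⟩
    · rw [pow_succ]; omega
    · have e1 : (N * m) ^ 2 ^ i ≤ m' ^ 2 ^ (i + 1) := by
        rw [pow_succ 2 i, mul_comm (2 ^ i) 2, pow_mul]
        exact Nat.pow_le_pow_left hlow _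
      calc N ^ 2 ^ (i + 1) = N ^ 2 ^ i * N ^ 2 ^ i := by rw [← pow_add]; congr 1; ring
        _ ≤ N ^ 2 ^ i * (N * m ^ 2 ^ i) := Nat.mul_le_mul le_rfl hNm
        _ = N * (N * m) ^ 2 ^ i := by rw [mul_pow]; ring
        _ ≤ _ := Nat.mul_le_mul le_rfl e1
    · refine le_trans ?_ c3
      set E := 780 * (11 + D) + 4 with hE
      have hcost : (2 * r + 1) * L / m * (64 * (m' : ℝ) ^ 2 * ((11 + D) * r * L) + 1) + Real.log 2
          ≤ 9 * E * 4 ^ i * L ^ 2 * N := by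
        have e1 : (2 * (r : ℝ) + 1) * L / m ≤ 3 * r * L / m := by gcongr; linarith
        have hΛ1 : 1 ≤ (11 + D) * r * L := by
          have : 11 * L ≤ (11 + D) * r * L := by
            have : 11 * 1 ≤ (11 + D) * r := by gcongr; linarith
            nlinarith
          linarith
        have e2 : 64 * (m' : ℝ) ^ 2 * ((11 + D) * r * L) + 1 ≤ 65 * ((4 * (N * m)) * ((11 + D) * r * L)) := by
          have f1 : (m' : ℝ) ^ 2 ≤ 4 * (N * m) := by exact_mod_cast hup
          have f2 : 1 ≤ (m' : ℝ) ^ 2 := one_le_pow₀ hm'0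
          have f3 := mul_le_mul_of_nonneg_right f1 (by linarith : (0:ℝ) ≤ (11 + D) * r * L)
          have f4 : 1 * 1 ≤ (m' : ℝ) ^ 2 * ((11 + D) * r * L) := by gcongr
          nlinarith
        have e3 : (2 * r + 1) * L / m * (64 * (m' : ℝ) ^ 2 * ((11 + D) * r * L) + 1) ≤
            780 * (11 + D) * (r ^ 2 * L ^ 2 * N) := by
          calc _ ≤ 3 * r * L / m * (65 * ((4 * (N * m)) * ((11 + D) * r * L))) := by gcongr
            _ = _ := by field_simp; ring
        have e4 : Real.log 2 ≤ 4 * (r ^ 2 * L ^ 2 * N) := by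
          have f1 : (1 : ℝ) ^ 2 * (1 / 2) ^ 2 * 1 ≤ r ^ 2 * L ^ 2 * N := by gcongr
          linarith
        have e5 : (r : ℝ) ^ 2 ≤ 9 * 4 ^ i := by
          have : (r : ℝ) ≤ 3 * 2 ^ i := by
            have : r ≤ 3 * 2 ^ i := by omega
            exact_mod_cast this
          calc (r : ℝ) ^ 2 ≤ (3 * 2 ^ i) ^ 2 := by gcongr
            _ = 9 * 4 ^ i := by rw [mul_pow, ← pow_mul, mul_comm i, pow_mul]; norm_num
        calc _ ≤ E * (r ^ 2 * L ^ 2 * N) := by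
              have : E * (r ^ 2 * L ^ 2 * N) = 780 * (11 + D) * (r ^ 2 * L ^ 2 * N) +
                  4 * (r ^ 2 * L ^ 2 * N) := by rw [hE]; ring
              linarith
          _ ≤ E * ((9 * 4 ^ i) * L ^ 2 * N) := by gcongr
          _ = _ := by ring
      have h2 : Real.exp (-Real.log 2) = 1 / 2 := by
        rw [Real.exp_neg, Real.exp_log (by norm_num)]; norm_num
      calc (A.card : ℝ) * Real.exp (-(3 * E * 4 ^ (i + 1) * L ^ 2 * N))
          ≤ A.card * Real.exp (-(3 * E * 4 ^ i * L ^ 2 * N) +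
            (-((2 * r + 1) * L / m * (64 * m' ^ 2 * ((11 + D) * r * L) + 1)) + -Real.log 2)) := by
            gcongr
            rw [pow_succ]
            linarith
        _ = (A.card * Real.exp (-(3 * E * 4 ^ i * L ^ 2 * N))) *
            Real.exp (-((2 * r + 1) * L / m * (64 * m' ^ 2 * ((11 + D) * r * L) + 1))) / 2 := by
            rw [Real.exp_add, Real.exp_add, h2]; ring
        _ ≤ _ := by gcongr


theorem iterSum_coe {G : Type} [AddCommGroup G] [DecidableEq G] (X : Finset G) (n : ℕ) :
    iterSum n (X : Set G) = ((n • X : Finset G) : Set G) := by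
  induction n with
  | zero => simp [iterSum]; rfl
  | succ n ih => rw [iterSum, ih, succ_nsmul', Finset.coe_add]

theorem haar_coe {G : Type} [AddCommGroup G] [Fintype G] (X : Finset G) :
    haar (X : Set G) = (X.card : ℝ) / (Fintype.card G : ℝ) := by
  simp [haar]

set_option maxHeartbeats 1000000 in
theorem finMain {G : Type} [AddCommGroup G] [DecidableEq G] [Fintype G] (A : Finset G)
    (hA : A.Nonempty) (K L l u : ℝ) (hK : ((A + A).card : ℝ) ≤ K * A.card)
    (hLdef : L = Real.log (2 * K)) (hldef : l = Real.log (2 * L)) (hu : u = L * l) :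
    ∃ (X : Finset G) (m r k : ℕ), (0 : G) ∈ X ∧ -X = X ∧
      (∀ n : ℕ, 1 ≤ n → (n • X).card ≤ n ^ (4 * k) * X.card) ∧
      (k : ℝ) ≤ 2 ^ 61 * u ^ 3 ∧
      (A.card : ℝ) * Real.exp (-(2 ^ 58 * u ^ 3)) ≤ X.card ∧
      u ≤ m ∧ (r : ℝ) ≤ 558 * l ∧ m • X ⊆ r • (A - A) := by
  have hc : (0 : ℝ) < A.card := by exact_mod_cast hA.card_pos
  have hl2 := Real.log_two_gt_d9
  have hl2' := Real.log_two_lt_d9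
  have hK1 : 1 ≤ K := by
    obtain ⟨a, ha⟩ := hA
    have h1 : A.card ≤ (A + A).card := by
      apply Finset.card_le_card_of_injOn (fun x => x + a)
      · intro x hx
        exact Finset.mem_coe.2 (Finset.add_mem_add (Finset.mem_coe.1 hx) ha)
      · intro x _ y _ h
        exact add_right_cancel h
    have h2 : (A.card : ℝ) ≤ (A + A).card := by exact_mod_cast h1
    by_contra hcon
    push Not at hcon
    nlinarith
  have hLK : L = Real.log 2 + Real.log K := by
    rw [hLdef, Real.log_mul (by norm_num) (by linarith)]
  have hlK0 := Real.log_nonneg hK1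
  have hL2 : Real.log 2 ≤ L := by linarith
  have hKL : Real.log K ≤ L := by linarith
  have hL69 : 0.69 ≤ L := by linarith
  have hl4 : 1 / 4 ≤ l := by
    have h := Real.one_sub_inv_le_log_of_pos (x := 2 * L) (by linarith)
    have h' : (2 * L)⁻¹ ≤ (1.38 : ℝ)⁻¹ := inv_anti₀ (by norm_num) (by linarith)
    rw [hldef]
    norm_num at h' ⊢
    norm_num at h
    linarith
  have hlL : l ≤ 2 * L := by
    have := Real.log_le_sub_one_of_pos (x := 2 * L) (by linarith)
    rw [hldef]; linarith
  have hu6 : 1 / 6 ≤ u := by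
    rw [hu]
    have : (0.69 : ℝ) * (1 / 4) ≤ L * l := by gcongr
    linarith
  set N := ⌈2 ^ 20 * u⌉₊ with hN
  have hNlow : 2 ^ 20 * u ≤ N := Nat.le_ceil _
  have hNup : (N : ℝ) ≤ 2 ^ 21 * u := by
    have := (Nat.ceil_lt_add_one (a := 2 ^ 20 * u) (by positivity)).le
    rw [← hN] at this
    have e : (2 : ℝ) ^ 21 = 2 * 2 ^ 20 := by norm_num
    have e' : (6 : ℝ) ≤ 2 ^ 20 := by norm_num
    rw [e]
    nlinarith
  have hN1 : 1 < N := by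
    have : (1 : ℝ) < N := by norm_num at hNlow; linarith
    exact_mod_cast this
  have hlogN : Real.log N ≤ 61 * l := by
    have hl0 : 0 < l := by linarith
    have hL0 : 0 < L := by linarith
    have h1 : Real.log N ≤ Real.log (2 ^ 21 * (L * l)) := by
      rw [← hu]
      exact Real.log_le_log (by positivity) hNup
    rw [Real.log_mul (by positivity) (by positivity), Real.log_mul hL0.ne' hl0.ne',
      Real.log_pow] at h1
    have h2 : Real.log L ≤ l := by
      rw [hldef]; exact Real.log_le_log hL0 (by linarith)
    have h3 : Real.log l ≤ l := by
      have := Real.log_le_sub_one_of_pos hl0; linarith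
    push_cast at h1
    linarith
  have hD : Real.log (4 * N) ≤ 124 * L := by
    rw [Real.log_mul (by norm_num) (by positivity), show (4 : ℝ) = 2 ^ 2 by norm_num, Real.log_pow]
    push_cast
    linarith
  set c := Nat.clog 2 N with hcdef
  set J := Nat.clog 2 c with hJ
  have hc1 : 1 ≤ c := Nat.clog_pos (by norm_num) hN1
  have hcl : (c : ℝ) ≤ 93 * l := by
    have h1 : 2 ^ (c - 1) < N := Nat.pow_pred_clog_lt_self (by norm_num) hN1
    have h2 : ((2 : ℝ)) ^ (c - 1) ≤ N := by exact_mod_cast h1.le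
    have h3 := Real.log_le_log (by positivity) h2
    rw [Real.log_pow, Nat.cast_sub hc1, Nat.cast_one] at h3
    have hc1' : (1 : ℝ) ≤ c := by exact_mod_cast hc1
    have h4 : ((c : ℝ) - 1) * 0.693 ≤ (c - 1) * Real.log 2 := by
      apply mul_le_mul_of_nonneg_left _ (by linarith)
      linarith
    norm_num at h4
    linarith
  have hJc : 2 ^ J ≤ 2 * c := by
    rcases Nat.lt_or_ge 1 c with h | h
    · have h1 : 2 ^ (J - 1) < c := Nat.pow_pred_clog_lt_self (by norm_num) h
      have hJ1 : 1 ≤ J := Nat.clog_pos (by norm_num) h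
      have : 2 ^ J = 2 * 2 ^ (J - 1) := by
        rw [← pow_succ']; congr 1; omega
      omega
    · have : c = 1 := le_antisymm h hc1
      have hJ0 : J = 0 := by rw [hJ, this]; simp
      rw [hJ0]; omega
  have hNJ : N ≤ 2 ^ 2 ^ J := by
    refine (Nat.le_pow_clog (by norm_num : 1 < 2) N).trans ?_
    exact Nat.pow_le_pow_right (by norm_num) (Nat.le_pow_clog (by norm_num) c)
  have hJl : (2 : ℝ) ^ J ≤ 186 * l := by
    have : ((2 ^ J : ℕ) : ℝ) ≤ ((2 * c : ℕ) : ℝ) := by exact_mod_cast hJc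
    push_cast at this
    linarith
  obtain ⟨X, m, r, h0, hs, hm1, hm4, hr, hNm, hX, hXc⟩ :=
    iter A hA K L 124 N hK1 hKL hL2 hN1.le (by norm_num) hD hK J
  have hmN : N ≤ 2 * m := by
    by_contra hcon
    push Not at hcon
    have h1 : (2 * m) ^ 2 ^ J < N ^ 2 ^ J := Nat.pow_lt_pow_left hcon (by positivity)
    have h2 : N ^ 2 ^ J ≤ (2 * m) ^ 2 ^ J := by
      rw [mul_pow]
      exact hNm.trans (Nat.mul_le_mul hNJ le_rfl)
    omega
  have hmu : 2 ^ 19 * u ≤ m := by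
    have : (N : ℝ) ≤ 2 * m := by exact_mod_cast hmN
    norm_num at hNlow ⊢
    linarith
  have hrl : (r : ℝ) ≤ 558 * l := by
    have : (r : ℝ) + 2 = 3 * 2 ^ J := by exact_mod_cast hr
    linarith
  have hr1 : 1 ≤ r := by
    have : 1 ≤ 2 ^ J := Nat.one_le_two_pow
    omega
  have hr0 : (1 : ℝ) ≤ r := by exact_mod_cast hr1
  have hL0 : 0 < L := by linarith
  have hl0 : 0 < l := by linarith
  have hu0 : 0 < u := by linarith
  have hm0 : (0 : ℝ) < m := by exact_mod_cast hm1
  have hrL : 100 * (r * L) ≤ m := by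
    have : (r : ℝ) * L ≤ 558 * u := by
      rw [hu]
      have := mul_le_mul_of_nonneg_right hrl hL0.le
      linarith
    norm_num at hmu
    linarith
  have hcost : 3 * (780 * (11 + 124) + 4) * 4 ^ J * L ^ 2 * (N : ℝ) ≤ 2 ^ 58 * u ^ 3 := by
    have h4J : (4 : ℝ) ^ J ≤ 186 ^ 2 * l ^ 2 := by
      calc (4 : ℝ) ^ J = (2 ^ J) ^ 2 := by rw [← pow_mul, mul_comm, pow_mul]; norm_num
        _ ≤ (186 * l) ^ 2 := by gcongr
        _ = _ := by ring
    calc 3 * (780 * (11 + 124) + 4) * 4 ^ J * L ^ 2 * (N : ℝ)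
        ≤ 3 * (780 * (11 + 124) + 4) * (186 ^ 2 * l ^ 2) * L ^ 2 * (2 ^ 21 * u) := by gcongr
      _ = (3 * (780 * (11 + 124) + 4) * 186 ^ 2 * 2 ^ 21) * u ^ 3 := by rw [hu]; ring
      _ ≤ _ := by gcongr; norm_num
  have hXc2 : (A.card : ℝ) * Real.exp (-(2 ^ 58 * u ^ 3)) ≤ X.card := by
    refine le_trans ?_ hXc
    gcongr
  set w := 2 * (r * L) + 2 ^ 58 * u ^ 3 + 1 with hw
  have hw0 : 1 ≤ w := by
    have : 0 ≤ 2 * (r * L) + 2 ^ 58 * u ^ 3 := by positivity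
    linarith
  set k := ⌈4 * w⌉₊ with hk
  have hk4 : 4 * w ≤ k := Nat.le_ceil _
  have hkup : (k : ℝ) ≤ 4 * w + 1 := (Nat.ceil_lt_add_one (by linarith)).le
  have hk1 : 1 ≤ k := by
    have : (1 : ℝ) ≤ k := by linarith
    exact_mod_cast this
  have hchang : ((3 * k + 1) • X).card < 2 ^ k * X.card := by
    set q := (3 * k + 1) / m + 1 with hq
    have hqm : 3 * k + 1 ≤ m * q := by
      have := Nat.lt_mul_div_succ (3 * k + 1) hm1
      exact this.le
    have hsub : (3 * k + 1) • X ⊆ (r * q) • A - (r * q) • A := by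
      calc (3 * k + 1) • X ⊆ (m * q) • X := nsmul_mono_left X h0 hqm
        _ = q • (m • X) := by rw [mul_nsmul]
        _ ⊆ q • (r • (A - A)) := nsmul_mono_right hX q
        _ = _ := by rw [← mul_nsmul, nsmul_sub]
    have h1 : (((3 * k + 1) • X).card : ℝ) ≤ K ^ (r * q + r * q) * A.card := by
      refine le_trans ?_ (plun A hA K hK (r * q) (r * q))
      exact_mod_cast Finset.card_le_card hsub
    have h2 : K ^ (r * q + r * q) ≤ Real.exp (2 * (r * L) * q) := by
      have : K ≤ Real.exp L := by rwa [← Real.log_le_iff_le_exp (by linarith)]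
      calc K ^ (r * q + r * q) ≤ (Real.exp L) ^ (r * q + r * q) :=
            pow_le_pow_left₀ (by linarith) this _
        _ = _ := by rw [← Real.exp_nat_mul]; congr 1; push_cast; ring
    have hqr : (q : ℝ) ≤ (3 * k + 1) / m + 1 := by
      have := Nat.cast_div_le (α := ℝ) (m := 3 * k + 1) (n := m)
      push_cast at this
      rw [hq]; push_cast; linarith
    have h3 : 2 * (r * L) * q ≤ (3 * k + 1) / 50 + 2 * (r * L) := by
      calc 2 * (r * L) * q ≤ 2 * (r * L) * ((3 * k + 1) / m + 1) := by gcongr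
        _ = (100 * (r * L)) * ((3 * k + 1) / m) / 50 + 2 * (r * L) := by ring
        _ ≤ m * ((3 * k + 1) / m) / 50 + 2 * (r * L) := by gcongr
        _ = _ := by rw [mul_div_cancel₀]; exact hm0.ne'
    have h4 : (A.card : ℝ) ≤ Real.exp (2 ^ 58 * u ^ 3) * X.card := by
      calc (A.card : ℝ) = Real.exp (2 ^ 58 * u ^ 3) * (A.card * Real.exp (-(2 ^ 58 * u ^ 3))) := by
            rw [mul_comm (A.card : ℝ), ← mul_assoc, ← Real.exp_add]; simp
        _ ≤ _ := by gcongr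
    have hXpos : (0 : ℝ) < X.card := by
      exact_mod_cast Finset.card_pos.2 ⟨0, h0⟩
    have h5 : (((3 * k + 1) • X).card : ℝ) < 2 ^ k * X.card := by
      calc (((3 * k + 1) • X).card : ℝ) ≤ K ^ (r * q + r * q) * A.card := h1
        _ ≤ Real.exp (2 * (r * L) * q) * (Real.exp (2 ^ 58 * u ^ 3) * X.card) := by gcongr
        _ = Real.exp (2 * (r * L) * q + 2 ^ 58 * u ^ 3) * X.card := by
            rw [Real.exp_add]; ring
        _ < Real.exp (k * Real.log 2) * X.card := by
            gcongr
            have : (k : ℝ) * 0.693 ≤ k * Real.log 2 := by gcongr; linarith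
            norm_num at this
            linarith
        _ = _ := by rw [Real.exp_nat_mul, Real.exp_log (by norm_num)]
    exact_mod_cast h5
  refine ⟨X, m, r, k, h0, hs, ?_, ?_, hXc2, ?_, hrl, hX⟩
  · intro n hn
    rcases Nat.lt_or_ge n 2 with h | h
    · have : n = 1 := by omega
      rw [this]; simp
    · obtain ⟨n', rfl⟩ := Nat.exists_eq_add_of_le' h
      have h1 := chang X h0 hs k hchang n'
      have h2 : (2 • X).card ≤ 2 ^ k * X.card :=
        (Finset.card_le_card (nsmul_mono_left X h0 (by omega))).trans hchang.le
      calc ((n' + 2) • X).card ≤ (2 * n' + 1) ^ k * (2 ^ k * X.card) :=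
            h1.trans (Nat.mul_le_mul le_rfl h2)
        _ = ((2 * n' + 1) * 2) ^ k * X.card := by rw [mul_pow]; ring
        _ ≤ ((n' + 2) ^ 4) ^ k * X.card := by
            refine Nat.mul_le_mul (Nat.pow_le_pow_left ?_ k) le_rfl
            have : (n' + 2) ^ 4 = n' ^ 4 + 8 * n' ^ 3 + 24 * n' ^ 2 + 32 * n' + 16 := by ring
            rw [this]
            omega
        _ = _ := by rw [← pow_mul]
  · have e1 : (r : ℝ) * L ≤ 558 * u := by
      rw [hu]
      have := mul_le_mul_of_nonneg_right hrl hL0.le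
      linarith
    have e2 : 1 ≤ 216 * u ^ 3 := by
      have : (1 / 6 : ℝ) ^ 3 ≤ u ^ 3 := by gcongr
      norm_num at this
      linarith
    have e3 : u ≤ 36 * u ^ 3 := by
      have : (1 / 6 : ℝ) ^ 2 ≤ u ^ 2 := by gcongr
      norm_num at this
      nlinarith
    have e4 : (k : ℝ) ≤ 4 * (2 * (558 * (36 * u ^ 3)) + 2 ^ 58 * u ^ 3 + 216 * u ^ 3) + 216 * u ^ 3 := by
      rw [hw] at hkup
      linarith
    have e5 : 0 ≤ u ^ 3 := by positivity
    norm_num at e4 ⊢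
    linarith
  · norm_num at hmu
    linarith


/-- Lemma 5.2, Croot–Sisask type structure. -/
theorem statement5 :
    ∃ C c : ℝ, 0 < C ∧ 0 < c ∧
      ∀ (G : Type) [AddCommGroup G] [Fintype G], ∀ (A : Set G) (K : ℝ),
        A.Nonempty → haar (A + A) ≤ K * haar A →
        ∃ X : Set G, (0 : G) ∈ X ∧ X = -X ∧
          HasRPG X (C * Real.log (2 * K) ^ 3 * Real.log (2 * Real.log (2 * K)) ^ 3) ∧
          Real.exp (-(C * Real.log (2 * K) ^ 3 * Real.log (2 * Real.log (2 * K)) ^ 3)) *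
              haar A ≤ haar X ∧
          ∃ m r : ℕ,
            c * Real.log (2 * K) * Real.log (2 * Real.log (2 * K)) ≤ (m : ℝ) ∧
            (r : ℝ) ≤ C * Real.log (2 * Real.log (2 * K)) ∧
            iterSum m X ⊆ iterSum r (A - A) := by
  classical
  refine ⟨2 ^ 63, 1, by norm_num, by norm_num, ?_⟩
  intro G _ _ A K hA hK
  have hG : (0 : ℝ) < Fintype.card G := by exact_mod_cast Fintype.card_pos
  obtain ⟨A', rfl⟩ : ∃ A' : Finset G, (A' : Set G) = A := ⟨A.toFinset, by simp⟩
  rw [← Finset.coe_add, haar_coe, haar_coe, ← mul_div_assoc, div_le_div_iff_of_pos_right hG] at hK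
  obtain ⟨X, m, r, k, h0, hs, hgr, hk, hXc, hm, hr, hX⟩ :=
    finMain A' (by exact_mod_cast hA) K _ _ _ hK rfl rfl rfl
  set L := Real.log (2 * K) with hL
  set l := Real.log (2 * L) with hl
  have hu3 : 0 ≤ (L * l) ^ 3 := by
    have : (0 : ℝ) ≤ k := Nat.cast_nonneg k
    norm_num at hk
    linarith
  have hl0 : 0 ≤ l := by
    have : (0 : ℝ) ≤ r := Nat.cast_nonneg r
    linarith
  have hd : (2 : ℝ) ^ 63 * L ^ 3 * l ^ 3 = 2 ^ 63 * (L * l) ^ 3 := by ring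
  refine ⟨X, by exact_mod_cast h0, ?_, ?_, ?_, m, r, ?_, ?_, ?_⟩
  · rw [← Finset.coe_neg, hs]
  · intro n hn
    rw [iterSum_coe, haar_coe, haar_coe, ← mul_div_assoc, div_le_div_iff_of_pos_right hG, hd]
    have h1 : ((n • X).card : ℝ) ≤ (n : ℝ) ^ (4 * k) * X.card := by exact_mod_cast hgr n hn
    refine h1.trans ?_
    gcongr
    rw [← Real.rpow_natCast]
    apply Real.rpow_le_rpow_of_exponent_le (by exact_mod_cast hn)
    push_cast
    norm_num at hk ⊢
    linarith
  · rw [haar_coe, haar_coe, ← mul_div_assoc, div_le_div_iff_of_pos_right hG, hd, mul_comm]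
    refine le_trans ?_ hXc
    gcongr
    · norm_num
    · norm_num
  · rw [one_mul]; exact hm
  · norm_num
    linarith
  · rw [← Finset.coe_sub, iterSum_coe, iterSum_coe]
    exact_mod_cast hX

end Paper
end

section
/- There is an absolute constant C > 0 such that the following holds. Let G be a finite abelian group, A ⊆ G nonempty, B a Bohr system on G, μ a B-approximately invariant probability measure, S ⊆ B₁ with μ(S) > 0, ε ∈ (0,1], and L ⊆ G nonempty with ‖1_L ∗ μ_S‖²_{L₂(m_G)} ≥ ε·m_G(L). Then there is a Bohr system B' ≤ B with C^Δ(A;B'₁) ≤ (2·ε⁻¹)^{C·ε⁻²·log(2·μ(S)⁻¹)}·C^Δ(A;B₁) and dim B' ≤ dim B + C·ε⁻²·log(2·μ(S)⁻¹), such that B'₁ ⊆ L − L + S − S. -/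
open scoped BigOperators Pointwise ENNReal ENat
open Real

namespace Paper

lemma prod_weight_sum {G : Type} [Fintype G] (w : G → ℝ) (r : ℕ) :
    ∑ s : Fin r → G, ∏ j, w (s j) = (∑ x, w x) ^ r := by
  exact (Fintype.sum_pow w r).symm

lemma var_sum {G : Type} [Fintype G] (w : G → ℝ) (hw1 : ∑ x, w x = 1) (Y : G → ℂ)
    (hY : ∑ x, (w x : ℂ) * Y x = 0) (r : ℕ) :
    ∀ c : ℂ, ∑ s : Fin r → G, (∏ j, w (s j)) * ‖c + ∑ j, Y (s j)‖ ^ 2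
      = ‖c‖ ^ 2 + r * ∑ x, w x * ‖Y x‖ ^ 2 := by
  have key : ∀ c : ℂ, ∑ x, w x * ‖c + Y x‖ ^ 2 = ‖c‖ ^ 2 + ∑ x, w x * ‖Y x‖ ^ 2 := by
    intro c
    have h1 : ∀ x, w x * ‖c + Y x‖ ^ 2 = w x * ‖c‖ ^ 2 + w x * ‖Y x‖ ^ 2 +
        2 * ((starRingEnd ℂ c) * ((w x : ℂ) * Y x)).re := by
      intro x
      simp only [← Complex.normSq_eq_norm_sq, Complex.normSq_apply]
      simp
      ring
    simp_rw [h1, Finset.sum_add_distrib, ← Finset.sum_mul, ← Finset.mul_sum, hw1, ← Complex.re_sum,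
      ← Finset.mul_sum, hY]
    simp
  induction r with
  | zero => intro c; simp
  | succ r ih =>
    intro c
    rw [← (Fin.consEquiv (fun _ : Fin (r+1) => G)).sum_comp, Fintype.sum_prod_type]
    simp only [Fin.consEquiv_apply, Fin.prod_univ_succ, Fin.sum_univ_succ, Fin.cons_zero,
      Fin.cons_succ]
    have : ∀ x, ∑ s : Fin r → G, w x * (∏ j, w (s j)) * ‖c + (Y x + ∑ j, Y (s j))‖ ^ 2
        = w x * ‖c + Y x‖ ^ 2 + w x * (r * ∑ x, w x * ‖Y x‖ ^ 2) := by
      intro x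
      rw [← mul_add, ← ih (c + Y x), Finset.mul_sum]
      refine Finset.sum_congr rfl fun s _ => ?_
      rw [add_assoc]; ring
    simp_rw [this, Finset.sum_add_distrib, ← Finset.sum_mul, hw1, key]
    push_cast; ring

/-- The set of good samples. -/
lemma good_samples {G I : Type} [AddCommGroup G] [Fintype G] [Fintype I] (w : G → ℝ)
    (hw0 : ∀ x, 0 ≤ w x) (hw1 : ∑ x, w x = 1) (z : I → AddChar G ℂ) (c : I → ℂ)
    (hc : ∀ i, c i = ∑ x, (w x : ℂ) * z i x) (ε θ : ℝ) (hε : 0 < ε) (hθ : 0 < θ)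
    (hcε : ∀ i, ε ≤ ‖c i‖ ^ 2) (r : ℕ) (hr : 2 ≤ r * (θ * ε)) :
    ∃ D : Set (Fin r → G), (1 / 2 ≤ ∑ s : Fin r → G, D.indicator (fun s => ∏ j, w (s j)) s) ∧
      ∀ s ∈ D, ∑ i, ‖1 - (r : ℂ)⁻¹ * ∑ j, z i (s j) / c i‖ ^ 2 ≤ Fintype.card I * θ := by
  classical
  have hr0 : (r : ℝ) ≠ 0 := by
    rintro h; rw [h] at hr; norm_num at hr
  have hrC : (r : ℂ) ≠ 0 := by exact_mod_cast hr0
  have hrpos : (0 : ℝ) < r := lt_of_le_of_ne (Nat.cast_nonneg _) (Ne.symm hr0)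
  have hc0 : ∀ i, c i ≠ 0 := by
    intro i h
    have := hcε i
    rw [h] at this; simp at this; linarith
  set Q : (Fin r → G) → ℝ := fun s => ∑ i, ‖1 - (r : ℂ)⁻¹ * ∑ j, z i (s j) / c i‖ ^ 2 with hQ
  have hQ0 : ∀ s, 0 ≤ Q s := fun s => Finset.sum_nonneg fun i _ => by positivity
  have hP0 : ∀ s : Fin r → G, 0 ≤ ∏ j, w (s j) := fun s => Finset.prod_nonneg fun j _ => hw0 _
  have hone : ∀ i, ∑ s : Fin r → G, (∏ j, w (s j)) *
      ‖1 - (r : ℂ)⁻¹ * ∑ j, z i (s j) / c i‖ ^ 2 ≤ θ / 2 := by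
    intro i
    have hY : ∑ x, (w x : ℂ) * (1 - z i x / c i) = 0 := by
      simp_rw [mul_sub, mul_one, Finset.sum_sub_distrib, mul_div_assoc', ← Finset.sum_div, ← hc i]
      rw [div_self (hc0 i), ← Complex.ofReal_sum, hw1]; simp
    have h1 := var_sum w hw1 (fun x => 1 - z i x / c i) hY r 0
    have h2 : ∀ s : Fin r → G, ‖1 - (r : ℂ)⁻¹ * ∑ j, z i (s j) / c i‖ ^ 2 =
        ((r : ℝ) ^ 2)⁻¹ * ‖(0 : ℂ) + ∑ j, (1 - z i (s j) / c i)‖ ^ 2 := by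
      intro s
      have : 1 - (r : ℂ)⁻¹ * ∑ j, z i (s j) / c i
          = (r : ℂ)⁻¹ * (0 + ∑ j, (1 - z i (s j) / c i)) := by
        simp [Finset.sum_sub_distrib, mul_sub, hrC]
      rw [this, norm_mul, mul_pow]
      simp
    simp_rw [h2, mul_left_comm, ← Finset.mul_sum, h1]
    have h3 : ∑ x, w x * ‖1 - z i x / c i‖ ^ 2 ≤ 1 / ε := by
      have e1 : ∀ x, w x * ‖1 - z i x / c i‖ ^ 2 = w x + w x * (1 / ‖c i‖ ^ 2)
          - 2 * ((w x : ℂ) * z i x / c i).re := by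
        intro x
        have : ‖1 - z i x / c i‖ ^ 2 = 1 + ‖z i x / c i‖ ^ 2 - 2 * (z i x / c i).re := by
          simp only [← Complex.normSq_eq_norm_sq]
          rw [Complex.normSq_apply, Complex.normSq_apply]
          simp only [Complex.sub_re, Complex.sub_im, Complex.one_re, Complex.one_im]
          ring
        rw [this, mul_div_assoc, Complex.re_ofReal_mul, norm_div, AddChar.norm_apply, div_pow]
        ring
      simp_rw [e1, Finset.sum_sub_distrib, Finset.sum_add_distrib, ← Finset.sum_mul,
        ← Finset.mul_sum, ← Complex.re_sum, ← Finset.sum_div, ← hc i, div_self (hc0 i), hw1]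
      have := one_div_le_one_div_of_le hε (hcε i)
      simp only [Complex.one_re]
      linarith
    have h4 : ((r : ℝ) ^ 2)⁻¹ * (‖(0 : ℂ)‖ ^ 2 + r * ∑ x, w x * ‖1 - z i x / c i‖ ^ 2)
        ≤ ((r : ℝ) ^ 2)⁻¹ * (r * (1 / ε)) := by
      gcongr
      simpa using mul_le_mul_of_nonneg_left h3 hrpos.le
    refine h4.trans ?_
    rw [show ((r : ℝ) ^ 2)⁻¹ * (r * (1 / ε)) = 1 / (r * ε) by field_simp]
    rw [div_le_div_iff₀ (by positivity) (by norm_num)]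
    linarith
  have htot : ∑ s : Fin r → G, (∏ j, w (s j)) * Q s ≤ Fintype.card I * (θ / 2) := by
    have : ∀ s : Fin r → G, (∏ j, w (s j)) * Q s =
        ∑ i, (∏ j, w (s j)) * ‖1 - (r : ℂ)⁻¹ * ∑ j, z i (s j) / c i‖ ^ 2 := fun s => by
      rw [hQ, Finset.mul_sum]
    rw [Finset.sum_congr rfl fun s _ => this s, Finset.sum_comm]
    refine (Finset.sum_le_sum fun i _ => hone i).trans ?_
    simp
  have hW : ∑ s : Fin r → G, ∏ j, w (s j) = 1 := by rw [prod_weight_sum, hw1, one_pow]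
  by_cases hI : Fintype.card I = 0
  · refine ⟨Set.univ, by simp [hW]; norm_num, ?_⟩
    have : IsEmpty I := Fintype.card_eq_zero_iff.1 hI
    intro s _; simp
  have hI' : (0 : ℝ) < Fintype.card I := by exact_mod_cast Nat.pos_of_ne_zero hI
  refine ⟨{s | Q s ≤ Fintype.card I * θ}, ?_, fun s hs => hs⟩
  have h5 : ∀ s : Fin r → G, (∏ j, w (s j)) ≤
      ({s | Q s ≤ Fintype.card I * θ} : Set _).indicator (fun s => ∏ j, w (s j)) s +
      (Fintype.card I * θ)⁻¹ * ((∏ j, w (s j)) * Q s) := by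
    intro s
    by_cases h : Q s ≤ Fintype.card I * θ
    · rw [Set.indicator_of_mem (by exact h)]
      have : 0 ≤ (Fintype.card I * θ)⁻¹ * ((∏ j, w (s j)) * Q s) := by
        have := hP0 s; have := hQ0 s; positivity
      linarith
    · rw [Set.indicator_of_notMem (by exact h), zero_add]
      push Not at h
      have : 1 ≤ (Fintype.card I * θ)⁻¹ * Q s := by
        rw [inv_mul_eq_div, one_le_div (by positivity)]; exact h.le
      nlinarith [hP0 s]
  have h6 := Finset.sum_le_sum fun s (_ : s ∈ Finset.univ) => h5 s
  rw [hW, Finset.sum_add_distrib, ← Finset.mul_sum] at h6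
  have h7 : (Fintype.card I * θ)⁻¹ * ∑ s : Fin r → G, (∏ j, w (s j)) * Q s ≤ 1 / 2 := by
    rw [inv_mul_le_iff₀ (by positivity)]
    linarith
  linarith

lemma pairs {G I Ω : Type} [AddCommGroup G] [Fintype G] [Fintype I] [Fintype Ω]
    (μ wp : G → ℝ) (hwp : IsProb wp) (hμ0 : ∀ x, 0 ≤ μ x) (S B1 : Set G)
    (hS : 0 < wMeasure μ S)
    (hinv : ∀ x ∈ B1, ∀ y, μ (y - x) ≤ 2 * wp y)
    (z : I → AddChar G ℂ) (ε θ : ℝ) (hε : 0 < ε) (hθ : 0 < θ)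
    (hcε : ∀ i, ε ≤ ‖∑ x, (restrictProb μ S x : ℂ) * z i x‖ ^ 2)
    (r : ℕ) (hr : 2 ≤ r * (θ * ε)) (t : Ω → G) (ht : ∀ a, t a ∈ B1)
    (K : Ω → Ω → ℝ) (hK0 : ∀ a b, 0 ≤ K a b) (β : ℝ) (hβ : 0 ≤ β)
    (hK : ∀ a b, ∑ i, ‖z i (t a) - z i (t b)‖ ^ 2 ≤ 4 * (Fintype.card I * θ) → β ≤ K a b) :
    β * (Fintype.card Ω * ((wMeasure μ S / 2) ^ r / 2)) ^ 2 ≤ ∑ a, ∑ b, K a b := by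
  classical
  set w := restrictProb μ S with hw
  have hw0 : ∀ x, 0 ≤ w x := fun x =>
    div_nonneg (Set.indicator_nonneg (fun x _ => hμ0 x) x) hS.le
  have hw1 : ∑ x, w x = 1 := by
    simp only [hw, restrictProb, ← Finset.sum_div]
    exact div_self hS.ne'
  obtain ⟨D, hD, hD2⟩ := good_samples w hw0 hw1 z _ (fun i => rfl) ε θ hε hθ hcε r hr
  set P : (Fin r → G) → ℝ := fun y => ∏ j, wp (y j) with hP
  have hP0 : ∀ y, 0 ≤ P y := fun y => Finset.prod_nonneg fun j _ => hwp.1 _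
  have hP1 : ∑ y, P y = 1 := by rw [hP, prod_weight_sum, hwp.2, one_pow]
  set e : Ω → (Fin r → G) → ℝ := fun a y => D.indicator 1 (fun j => y j - t a) with he
  have he0 : ∀ a y, 0 ≤ e a y := fun a y => Set.indicator_nonneg (by simp) _
  -- measure of each set
  have hmeas : ∀ a, (wMeasure μ S / 2) ^ r / 2 ≤ ∑ y, P y * e a y := by
    intro a
    have h1 : ∑ y, P y * e a y = ∑ s : Fin r → G, (∏ j, wp (s j + t a)) * D.indicator 1 s := by
      rw [← Equiv.sum_comp (Equiv.addRight (fun _ : Fin r => t a)) (fun y => P y * e a y)]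
      refine Finset.sum_congr rfl fun s _ => ?_
      simp [hP, he]
    rw [h1]
    have h2 : ∀ s : Fin r → G, (wMeasure μ S / 2) ^ r * D.indicator (fun s => ∏ j, w (s j)) s ≤
        (∏ j, wp (s j + t a)) * D.indicator 1 s := by
      intro s
      by_cases hs : s ∈ D
      · rw [Set.indicator_of_mem hs, Set.indicator_of_mem hs, Pi.one_apply, mul_one]
        rw [← Fin.prod_const, ← Finset.prod_mul_distrib]
        refine Finset.prod_le_prod (fun j _ => mul_nonneg (by positivity) (hw0 _)) fun j _ => ?_
        have h3 := hinv (t a) (ht a) (s j + t a)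
        rw [add_sub_cancel_right] at h3
        have h4 : wMeasure μ S * w (s j) ≤ μ (s j) := by
          simp only [hw, restrictProb]
          rw [mul_div_cancel₀ _ hS.ne']
          exact Set.indicator_le_self' (fun _ _ => hμ0 _) _
        linarith
      · simp [Set.indicator_of_notMem hs]
    refine le_trans ?_ (Finset.sum_le_sum fun s _ => h2 s)
    rw [← Finset.mul_sum, div_eq_mul_one_div]
    exact mul_le_mul_of_nonneg_left hD (by positivity)
  set E : (Fin r → G) → ℝ := fun y => ∑ a, e a y with hE
  have hcs : (∑ y, P y * E y) ^ 2 ≤ ∑ y, P y * E y ^ 2 := by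
    have h := Finset.sum_mul_sq_le_sq_mul_sq Finset.univ (fun y => √(P y)) (fun y => √(P y) * E y)
    have h1 : ∀ y, √(P y) * (√(P y) * E y) = P y * E y := fun y => by
      rw [← mul_assoc, Real.mul_self_sqrt (hP0 y)]
    have h2 : ∀ y, (√(P y) * E y) ^ 2 = P y * E y ^ 2 := fun y => by
      rw [mul_pow, Real.sq_sqrt (hP0 y)]
    simp_rw [h1, h2, Real.sq_sqrt (hP0 _), hP1, one_mul] at h
    exact h
  have hlow : (Fintype.card Ω : ℝ) * ((wMeasure μ S / 2) ^ r / 2) ≤ ∑ y, P y * E y := by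
    simp_rw [hE, Finset.mul_sum]
    rw [Finset.sum_comm]
    refine le_trans ?_ (Finset.sum_le_sum fun a _ => hmeas a)
    simp
  have hclose : ∀ a b y, β * (e a y * e b y) ≤ K a b := by
    intro a b y
    by_cases ha : (fun j => y j - t a) ∈ D
    · by_cases hb : (fun j => y j - t b) ∈ D
      · have e1 : e a y = 1 := by simp [he, ha]
        have e2 : e b y = 1 := by simp [he, hb]
        rw [e1, e2, mul_one, mul_one]
        apply hK
        have h1 := hD2 _ ha
        have h2 := hD2 _ hb
        have h3 : ∀ i, ‖z i (t a) - z i (t b)‖ ^ 2 ≤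
            2 * ‖1 - (r : ℂ)⁻¹ * ∑ j, z i (y j - t a) / (∑ x, (w x : ℂ) * z i x)‖ ^ 2 +
            2 * ‖1 - (r : ℂ)⁻¹ * ∑ j, z i (y j - t b) / (∑ x, (w x : ℂ) * z i x)‖ ^ 2 := by
          intro i
          set ci := ∑ x, (w x : ℂ) * z i x
          set Y := (r : ℂ)⁻¹ * ∑ j, z i (y j) / ci with hY
          have h4 : ∀ u : G, ‖1 - (r : ℂ)⁻¹ * ∑ j, z i (y j - u) / ci‖ = ‖z i u - Y‖ := by
            intro u
            have : z i u - Y = z i u * (1 - (r : ℂ)⁻¹ * ∑ j, z i (y j - u) / ci) := by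
              rw [mul_sub, mul_one, hY, mul_left_comm, Finset.mul_sum (a := z i u)]
              congr 2
              refine Finset.sum_congr rfl fun j _ => ?_
              rw [mul_div_assoc', ← AddChar.map_add_eq_mul, add_sub_cancel]
            rw [this, norm_mul, AddChar.norm_apply, one_mul]
          rw [h4, h4]
          have h5 : ‖z i (t a) - z i (t b)‖ ≤ ‖z i (t a) - Y‖ + ‖z i (t b) - Y‖ := by
            rw [show z i (t a) - z i (t b) = (z i (t a) - Y) - (z i (t b) - Y) by ring]
            exact norm_sub_le _ _
          nlinarith [norm_nonneg (z i (t a) - z i (t b)), sq_nonneg (‖z i (t a) - Y‖ - ‖z i (t b) - Y‖)]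
        refine (Finset.sum_le_sum fun i _ => h3 i).trans ?_
        rw [Finset.sum_add_distrib, ← Finset.mul_sum, ← Finset.mul_sum]
        linarith
      · have e2 : e b y = 0 := by simp [he, hb]
        simp [e2, hK0]
    · have e2 : e a y = 0 := by simp [he, ha]
      simp [e2, hK0]
  have hE2 : β * ∑ y, P y * E y ^ 2 ≤ ∑ a, ∑ b, K a b := by
    have h1 : ∀ y, β * (P y * E y ^ 2) ≤ P y * ∑ a, ∑ b, K a b := by
      intro y
      rw [mul_left_comm]
      refine mul_le_mul_of_nonneg_left ?_ (hP0 y)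
      rw [hE, sq, Finset.sum_mul_sum, Finset.mul_sum]
      refine Finset.sum_le_sum fun a _ => ?_
      rw [Finset.mul_sum]
      exact Finset.sum_le_sum fun b _ => hclose a b y
    rw [Finset.mul_sum]
    refine (Finset.sum_le_sum fun y _ => h1 y).trans ?_
    rw [← Finset.sum_mul, hP1, one_mul]
  refine le_trans (mul_le_mul_of_nonneg_left ?_ hβ) hE2
  refine le_trans ?_ hcs
  gcongr

lemma one_sub_char_sq_le {G : Type} [AddCommGroup G] [Fintype G] (γ : AddChar G ℂ) (x : G) :
    ‖1 - γ x‖ ^ 2 ≤ 4 := by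
  have h : ‖1 - γ x‖ ≤ 2 := by
    refine (norm_sub_le _ _).trans ?_
    rw [AddChar.norm_apply, norm_one]; norm_num
  nlinarith [norm_nonneg (1 - γ x)]

lemma exp_neg_le_lin (y : ℝ) (h0 : 0 ≤ y) (h4 : y ≤ 4) : Real.exp (-y) ≤ 1 - y / 5 := by
  have h1 : Real.exp (-y) ≤ 1 / (1 + y) := by
    rw [Real.exp_neg, one_div]
    apply inv_anti₀ (by linarith)
    have := Real.add_one_le_exp y
    linarith
  refine h1.trans ?_
  rw [div_le_iff₀ (by linarith)]
  nlinarith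

/-- Splitting a table with two columns according to a word. -/
def splitEquiv {X : Type} {m : ℕ} (a : Fin m → Bool) :
    (Fin m → Bool → X) ≃ (Fin m → X) × (Fin m → X) where
  toFun Z := (fun i => Z i (a i), fun i => Z i (!a i))
  invFun A := fun i c => if c = a i then A.1 i else A.2 i
  left_inv Z := by
    funext i c
    cases hc : c <;> cases ha : a i <;> simp [ha]
  right_inv A := by
    ext i <;> simp

lemma select {G : Type} [AddCommGroup G] [Fintype G]
    (μ wp : G → ℝ) (hwp : IsProb wp) (hμ0 : ∀ x, 0 ≤ μ x) (S B1 : Set G)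
    (hS : 0 < wMeasure μ S)
    (hinv : ∀ x ∈ B1, ∀ y, μ (y - x) ≤ 2 * wp y)
    (ε : ℝ) (hε : 0 < ε) (p : AddChar G ℂ → ℝ) (hp0 : ∀ γ, 0 ≤ p γ) (hp1 : ∑ γ, p γ = 1)
    (hp : ∀ γ, p γ ≠ 0 → ε ≤ ‖∑ x, (restrictProb μ S x : ℂ) * γ x‖ ^ 2)
    (r m : ℕ) (hr : 2 ≤ r * ((1 / 1000) * ε))
    (hm : (9 / 10 : ℝ) ^ m < Real.exp (-(m / 20 : ℝ)) * ((wMeasure μ S / 2) ^ r / 2) ^ 2) :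
    ∃ Λ : Fin m → AddChar G ℂ, ∀ t ∈ B1, (∀ i, ‖1 - Λ i t‖ ≤ 1 / 10) →
      ∑ γ, p γ * ‖1 - γ t‖ ^ 2 ≤ 1 := by
  classical
  by_contra hcon
  push Not at hcon
  choose t htB htΛ htp using hcon
  set K : (Fin m → Bool → AddChar G ℂ) → (Fin m → Bool) → (Fin m → Bool) → ℝ := fun Z a b =>
    Real.exp (-∑ i, if a i ≠ b i then ‖1 - Z i (b i) (t fun i => Z i (a i))‖ ^ 2 else 0) with hK
  set P : (Fin m → Bool → AddChar G ℂ) → ℝ := fun Z => ∏ i, ∏ c, p (Z i c) with hP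
  have hP0 : ∀ Z, 0 ≤ P Z := fun Z =>
    Finset.prod_nonneg fun i _ => Finset.prod_nonneg fun c _ => hp0 _
  have hpm : ∑ A : Fin m → AddChar G ℂ, ∏ i, p (A i) = 1 := by
    rw [prod_weight_sum, hp1, one_pow]
  have hPsplit : ∀ (a : Fin m → Bool) (A : (Fin m → AddChar G ℂ) × (Fin m → AddChar G ℂ)),
      P ((splitEquiv a).symm A) = (∏ i, p (A.1 i)) * ∏ i, p (A.2 i) := by
    intro a A
    rw [← Finset.prod_mul_distrib]
    refine Finset.prod_congr rfl fun i _ => ?_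
    cases ha : a i <;> simp [splitEquiv, ha, mul_comm]
  have hP1 : ∑ Z, P Z = 1 := by
    rw [← Equiv.sum_comp (splitEquiv (fun _ => true)).symm, Fintype.sum_prod_type]
    simp_rw [hPsplit, ← Finset.mul_sum, hpm, mul_one, hpm]
  -- the lower bound for each table
  have hlow : ∀ Z, P Z ≠ 0 → Real.exp (-(m / 20 : ℝ)) *
      ((2 : ℝ) ^ m * ((wMeasure μ S / 2) ^ r / 2)) ^ 2 ≤ ∑ a, ∑ b, K Z a b := by
    intro Z hZ
    have hZ' : ∀ i c, p (Z i c) ≠ 0 := by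
      intro i c h
      apply hZ
      exact Finset.prod_eq_zero (Finset.mem_univ i) (Finset.prod_eq_zero (Finset.mem_univ c) h)
    have := pairs (I := Fin m × Bool) (Ω := Fin m → Bool) μ wp hwp hμ0 S B1 hS hinv
      (fun i => Z i.1 i.2) ε (1 / 1000) hε (by norm_num) (fun i => hp _ (hZ' _ _)) r hr
      (fun a => t fun i => Z i (a i)) (fun a => htB _) (K Z) (fun a b => (Real.exp_pos _).le)
      (Real.exp (-(m / 20 : ℝ))) (Real.exp_pos _).le ?_
    · simpa using this
    intro a b hab
    simp only [hK]
    apply Real.exp_le_exp.2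
    apply neg_le_neg
    rw [Fintype.sum_prod_type] at hab
    simp only [Fintype.card_prod, Fintype.card_fin, Fintype.card_bool, Nat.cast_mul,
      Nat.cast_ofNat] at hab
    have h1 : ∀ i, (if a i ≠ b i then ‖1 - Z i (b i) (t fun i => Z i (a i))‖ ^ 2 else 0) ≤
        2 / 100 + 2 * ∑ c, ‖Z i c (t fun i => Z i (a i)) - Z i c (t fun i => Z i (b i))‖ ^ 2 := by
      intro i
      have h0 : ∀ c, 0 ≤ ‖Z i c (t fun i => Z i (a i)) - Z i c (t fun i => Z i (b i))‖ ^ 2 :=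
        fun c => by positivity
      split_ifs with h
      · have h2 := htΛ (fun i => Z i (b i)) i
        have h3 := Finset.single_le_sum (fun c _ => h0 c) (Finset.mem_univ (b i))
        have h4 : ‖1 - Z i (b i) (t fun i => Z i (a i))‖ ≤ 1 / 10 +
          ‖Z i (b i) (t fun i => Z i (a i)) - Z i (b i) (t fun i => Z i (b i))‖ := by
          refine le_trans ?_ (add_le_add_left h2 _)
          rw [show 1 - Z i (b i) (t fun i => Z i (a i)) = (1 - Z i (b i) (t fun i => Z i (b i))) -
            (Z i (b i) (t fun i => Z i (a i)) - Z i (b i) (t fun i => Z i (b i))) by ring]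
          exact norm_sub_le _ _
        set u := ‖Z i (b i) (t fun i => Z i (a i)) - Z i (b i) (t fun i => Z i (b i))‖
        have h5 := norm_nonneg (1 - Z i (b i) (t fun i => Z i (a i)))
        nlinarith [sq_nonneg (1 / 10 - u)]
      · have := Finset.sum_nonneg fun c (_ : c ∈ Finset.univ) => h0 c
        linarith
    refine (Finset.sum_le_sum fun i _ => h1 i).trans ?_
    rw [Finset.sum_add_distrib, ← Finset.mul_sum]
    simp only [Finset.sum_const, Finset.card_univ, Fintype.card_fin, nsmul_eq_mul]
    have : (0 : ℝ) ≤ m := Nat.cast_nonneg _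
    linarith
  -- the upper bound on average
  have hup : ∀ a b, ∑ Z, P Z * K Z a b ≤ ∏ i, if a i ≠ b i then (4 / 5 : ℝ) else 1 := by
    intro a b
    rw [← Equiv.sum_comp (splitEquiv a).symm, Fintype.sum_prod_type]
    have h1 : ∀ A A' : Fin m → AddChar G ℂ,
        P ((splitEquiv a).symm (A, A')) * K ((splitEquiv a).symm (A, A')) a b =
        (∏ i, p (A i)) * ∏ i, (p (A' i) *
          if a i ≠ b i then Real.exp (-‖1 - A' i (t A)‖ ^ 2) else 1) := by
      intro A A'
      rw [hPsplit, hK, mul_assoc, Finset.prod_mul_distrib]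
      congr 2
      beta_reduce
      rw [← Finset.sum_neg_distrib, Real.exp_sum]
      refine Finset.prod_congr rfl fun i _ => ?_
      have : (fun i => (splitEquiv a).symm (A, A') i (a i)) = A := by
        funext i; simp [splitEquiv]
      simp only [this]
      by_cases h : a i = b i
      · simp [h]
      · have h' : ¬ b i = a i := fun e => h e.symm
        simp [h, splitEquiv, h']
    have h2 : ∀ A : Fin m → AddChar G ℂ, ∑ A' : Fin m → AddChar G ℂ, ∏ i, (p (A' i) *
          if a i ≠ b i then Real.exp (-‖1 - A' i (t A)‖ ^ 2) else 1) ≤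
          ∏ i, if a i ≠ b i then (4 / 5 : ℝ) else 1 := by
      intro A
      have h3 := Finset.prod_univ_sum (fun _ : Fin m => (Finset.univ : Finset (AddChar G ℂ)))
        (fun i γ => p γ * if a i ≠ b i then Real.exp (-‖1 - γ (t A)‖ ^ 2) else 1)
      rw [Fintype.piFinset_univ] at h3
      rw [← h3]
      refine Finset.prod_le_prod (fun i _ => Finset.sum_nonneg fun γ _ => mul_nonneg (hp0 _) ?_)
        fun i _ => ?_
      · split_ifs <;> positivity
      · by_cases h : a i = b i
        · simp [h, hp1]
        · simp only [ne_eq, h, not_false_eq_true, if_true]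
          have h4 : ∀ γ, p γ * Real.exp (-‖1 - γ (t A)‖ ^ 2) ≤
              p γ - (p γ * ‖1 - γ (t A)‖ ^ 2) / 5 := by
            intro γ
            have := mul_le_mul_of_nonneg_left (exp_neg_le_lin _ (by positivity)
              (one_sub_char_sq_le γ (t A))) (hp0 γ)
            linarith
          refine (Finset.sum_le_sum fun γ _ => h4 γ).trans ?_
          rw [Finset.sum_sub_distrib, hp1, ← Finset.sum_div]
          have := htp A
          linarith
    simp_rw [h1, ← Finset.mul_sum]
    refine (Finset.sum_le_sum fun A _ => mul_le_mul_of_nonneg_left (h2 A)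
      (Finset.prod_nonneg fun i _ => hp0 _)).trans ?_
    rw [← Finset.sum_mul, hpm, one_mul]
  have hsum : ∑ a : Fin m → Bool, ∑ b : Fin m → Bool, ∏ i, (if a i ≠ b i then (4 / 5 : ℝ) else 1)
      = 2 ^ m * (9 / 5) ^ m := by
    have h1 : ∀ a : Fin m → Bool, ∑ b : Fin m → Bool,
        ∏ i, (if a i ≠ b i then (4 / 5 : ℝ) else 1) = (9 / 5) ^ m := by
      intro a
      have h3 := Finset.prod_univ_sum (fun _ : Fin m => (Finset.univ : Finset Bool))
        (fun i c => if a i ≠ c then (4 / 5 : ℝ) else 1)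
      rw [Fintype.piFinset_univ] at h3
      rw [← h3, ← Fin.prod_const]
      refine Finset.prod_congr rfl fun i _ => ?_
      cases a i <;> simp <;> norm_num
    simp_rw [h1]
    simp
  have hfin : Real.exp (-(m / 20 : ℝ)) * ((2 : ℝ) ^ m * ((wMeasure μ S / 2) ^ r / 2)) ^ 2 ≤
      2 ^ m * (9 / 5) ^ m := by
    rw [← hsum]
    calc _ = ∑ Z, P Z * (Real.exp (-(m / 20 : ℝ)) *
          ((2 : ℝ) ^ m * ((wMeasure μ S / 2) ^ r / 2)) ^ 2) := by
          rw [← Finset.sum_mul, hP1, one_mul]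
      _ ≤ ∑ Z, P Z * ∑ a, ∑ b, K Z a b := by
          refine Finset.sum_le_sum fun Z _ => ?_
          by_cases hZ : P Z = 0
          · simp [hZ]
          · exact mul_le_mul_of_nonneg_left (hlow Z hZ) (hP0 Z)
      _ = ∑ a, ∑ b, ∑ Z, P Z * K Z a b := by
          simp_rw [Finset.mul_sum]
          rw [Finset.sum_comm]
          refine Finset.sum_congr rfl fun a _ => ?_
          rw [Finset.sum_comm]
      _ ≤ _ := Finset.sum_le_sum fun a _ => Finset.sum_le_sum fun b _ => hup a b
  have h4 : (0 : ℝ) < 2 ^ m * 2 ^ m := by positivity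
  have h5 := mul_lt_mul_of_pos_left hm h4
  have h6 : (2 : ℝ) ^ m * 2 ^ m * (9 / 10) ^ m = 2 ^ m * (9 / 5) ^ m := by
    rw [mul_assoc, ← mul_pow 2 (9 / 10 : ℝ)]; norm_num
  rw [h6] at h5
  have h7 : Real.exp (-(m / 20 : ℝ)) * ((2 : ℝ) ^ m * ((wMeasure μ S / 2) ^ r / 2)) ^ 2 =
    2 ^ m * 2 ^ m * (Real.exp (-(m / 20 : ℝ)) * ((wMeasure μ S / 2) ^ r / 2) ^ 2) := by ring
  linarith

lemma fourier_corr {G : Type} [AddCommGroup G] [Fintype G] (g : G → ℝ) (t : G) :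
    ∑ γ : AddChar G ℂ, ‖∑ x, (g x : ℂ) * γ x‖ ^ 2 * (γ t).re =
      (Fintype.card G : ℝ) * ∑ x, g x * g (x + t) := by
  classical
  have key : ∑ γ : AddChar G ℂ, ((‖∑ x, (g x : ℂ) * γ x‖ ^ 2 : ℝ) : ℂ) * γ t =
      (Fintype.card G : ℂ) * ∑ x, (g x : ℂ) * g (x + t) := by
    have h1 : ∀ γ : AddChar G ℂ, ((‖∑ x, (g x : ℂ) * γ x‖ ^ 2 : ℝ) : ℂ) * γ t =
        ∑ x, ∑ y, (g x : ℂ) * g y * γ (x + t - y) := by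
      intro γ
      rw [Complex.ofReal_pow, ← Complex.mul_conj', map_sum, Finset.sum_mul_sum, Finset.sum_mul]
      refine Finset.sum_congr rfl fun x _ => ?_
      rw [Finset.sum_mul]
      refine Finset.sum_congr rfl fun y _ => ?_
      rw [map_mul, Complex.conj_ofReal, ← AddChar.map_neg_eq_conj, sub_eq_add_neg,
        AddChar.map_add_eq_mul, AddChar.map_add_eq_mul]
      ring
    simp_rw [h1]
    rw [Finset.sum_comm, Finset.mul_sum]
    refine Finset.sum_congr rfl fun x _ => ?_
    rw [Finset.sum_comm]
    simp_rw [← Finset.mul_sum, AddChar.sum_apply_eq_ite, sub_eq_zero]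
    simp
    ring
  have := congrArg Complex.re key
  rw [Complex.re_sum] at this
  simp_rw [Complex.re_ofReal_mul] at this
  rw [this]
  have e : (Fintype.card G : ℂ) * ∑ x, (g x : ℂ) * g (x + t) =
    (((Fintype.card G : ℝ) * ∑ x, g x * g (x + t) : ℝ) : ℂ) := by push_cast; rfl
  rw [e, Complex.ofReal_re]

lemma fourier_conv {G : Type} [AddCommGroup G] [Fintype G] (f w : G → ℝ) (γ : AddChar G ℂ) :
    ∑ x, (convR f w x : ℂ) * γ x = (∑ x, (f x : ℂ) * γ x) * ∑ y, (w y : ℂ) * γ y := by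
  unfold convR
  push_cast
  simp_rw [Finset.sum_mul]
  simp_rw [Finset.mul_sum]
  rw [Finset.sum_comm]
  conv_rhs => rw [Finset.sum_comm]
  refine Finset.sum_congr rfl fun y _ => ?_
  rw [← Equiv.sum_comp (Equiv.addRight y)]
  refine Finset.sum_congr rfl fun x _ => ?_
  simp [AddChar.map_add_eq_mul]
  ring

lemma norm_one_sub_sq {z : ℂ} (hz : ‖z‖ = 1) : ‖1 - z‖ ^ 2 = 2 - 2 * z.re := by
  have h : z.re * z.re + z.im * z.im = 1 := by
    have := Complex.normSq_eq_norm_sq z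
    rw [hz, Complex.normSq_apply] at this; linarith
  rw [← Complex.normSq_eq_norm_sq, Complex.normSq_apply]
  simp
  nlinarith

set_option maxHeartbeats 1000000 in
lemma fourier_part {G : Type} [AddCommGroup G] [Fintype G] (μ : G → ℝ)
    (S L : Set G) (hL : L.Nonempty) (ε : ℝ) (hε : 0 < ε)
    (h : ε * haar L ≤ (Fintype.card G : ℝ)⁻¹ *
              ∑ x : G, convR (L.indicator (1 : G → ℝ)) (restrictProb μ S) x ^ 2) :
    ∃ p : AddChar G ℂ → ℝ, (∀ γ, 0 ≤ p γ) ∧ ∑ γ, p γ = 1 ∧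
      (∀ γ, p γ ≠ 0 → ε / 4 ≤ ‖∑ x, (restrictProb μ S x : ℂ) * γ x‖ ^ 2) ∧
      ∀ t, ∑ γ, p γ * ‖1 - γ t‖ ^ 2 ≤ 1 → t ∈ L - L + S - S := by
  classical
  set F := convR (L.indicator (1 : G → ℝ)) (restrictProb μ S) with hF
  set a : AddChar G ℂ → ℝ := fun γ => ‖∑ x, ((L.indicator (1 : G → ℝ) x : ℝ) : ℂ) * γ x‖ ^ 2 with ha
  set c : AddChar G ℂ → ℝ := fun γ => ‖∑ x, (restrictProb μ S x : ℂ) * γ x‖ ^ 2 with hc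
  set N : ℝ := (Fintype.card G : ℝ) with hN
  have hN0 : 0 < N := by rw [hN]; exact_mod_cast Fintype.card_pos
  set l : ℝ := (Nat.card L : ℝ) with hl
  have hl0 : 0 < l := by
    rw [hl]; have := hL.to_subtype; exact_mod_cast Nat.card_pos
  have a0 : ∀ γ, 0 ≤ a γ := fun γ => sq_nonneg _
  have c0 : ∀ γ, 0 ≤ c γ := fun γ => sq_nonneg _
  have hsumL : ∑ x, L.indicator (1 : G → ℝ) x = l := by
    rw [hl, Nat.card_eq_fintype_card, Fintype.card_subtype]
    simp [Set.indicator_apply]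
  have hq : ∀ γ, ‖∑ x, (F x : ℂ) * γ x‖ ^ 2 = a γ * c γ := by
    intro γ; rw [hF, fourier_conv, norm_mul, mul_pow]
  have hcorr : ∀ t, ∑ γ, a γ * c γ * (γ t).re = N * ∑ x, F x * F (x + t) := by
    intro t; rw [← fourier_corr]; simp_rw [hq]
  have hpars : ∑ γ, a γ = N * l := by
    have := fourier_corr (L.indicator (1 : G → ℝ)) 0
    simp only [AddChar.map_zero_eq_one, Complex.one_re, mul_one, add_zero] at this
    rw [ha, this, ← hsumL]
    congr 1
    refine Finset.sum_congr rfl fun x _ => ?_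
    by_cases hx : x ∈ L <;> simp [hx]
  have hF2 : ε * l ≤ ∑ x, F x ^ 2 := by
    have : ε * (l / N) ≤ N⁻¹ * ∑ x, F x ^ 2 := h
    have h2 := mul_le_mul_of_nonneg_left this hN0.le
    rw [mul_inv_cancel_left₀ hN0.ne'] at h2
    calc ε * l = N * (ε * (l / N)) := by field_simp
      _ ≤ _ := h2
  have hall : ε * (N * l) ≤ ∑ γ, a γ * c γ := by
    have := hcorr 0
    simp only [AddChar.map_zero_eq_one, Complex.one_re, mul_one, add_zero] at this
    rw [this]
    simp_rw [← sq]
    nlinarith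
  set Spec : Finset (AddChar G ℂ) := Finset.univ.filter fun γ => ε / 4 ≤ c γ with hSpec
  have hsplit : ∀ f : AddChar G ℂ → ℝ, ∑ γ, f γ = ∑ γ ∈ Spec, f γ +
      ∑ γ ∈ Finset.univ.filter (fun γ => ¬ ε / 4 ≤ c γ), f γ := by
    intro f; rw [hSpec, Finset.sum_filter_add_sum_filter_not]
  have hoff : ∑ γ ∈ Finset.univ.filter (fun γ => ¬ ε / 4 ≤ c γ), a γ * c γ ≤ ε / 4 * (N * l) := by
    rw [← hpars, Finset.mul_sum]
    refine (Finset.sum_le_sum (g := fun γ => ε / 4 * a γ) fun γ hγ => ?_).trans ?_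
    · have := (Finset.mem_filter.1 hγ).2
      nlinarith [a0 γ]
    · exact Finset.sum_le_sum_of_subset_of_nonneg (Finset.filter_subset _ _)
        fun γ _ _ => mul_nonneg (by linarith) (a0 γ)
  set P0 := ∑ γ ∈ Spec, a γ * c γ with hP0
  have hP : 3 / 4 * ε * (N * l) ≤ P0 := by
    have := hsplit fun γ => a γ * c γ
    linarith
  have hNl : 0 < ε * (N * l) := by positivity
  have hPpos : 0 < P0 := by linarith
  refine ⟨fun γ => if γ ∈ Spec then a γ * c γ / P0 else 0, ?_, ?_, ?_, ?_⟩
  · intro γ; dsimp only; split_ifs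
    · exact div_nonneg (mul_nonneg (a0 γ) (c0 γ)) hPpos.le
    · rfl
  · rw [Finset.sum_ite_mem, Finset.univ_inter, ← Finset.sum_div, ← hP0, div_self hPpos.ne']
  · intro γ hγ
    by_cases h1 : γ ∈ Spec
    · exact (Finset.mem_filter.1 h1).2
    · simp [h1] at hγ
  · intro t ht
    have h1 : ∑ γ ∈ Spec, a γ * c γ * (2 - 2 * (γ t).re) ≤ P0 := by
      simp_rw [ite_mul, zero_mul] at ht
      rw [Finset.sum_ite_mem, Finset.univ_inter] at ht
      have := mul_le_mul_of_nonneg_left ht hPpos.le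
      rw [mul_one, Finset.mul_sum] at this
      refine le_trans (le_of_eq (Finset.sum_congr rfl fun γ _ => ?_)) this
      rw [norm_one_sub_sq (AddChar.norm_apply γ t)]
      field_simp
    have h2 : P0 / 2 ≤ ∑ γ ∈ Spec, a γ * c γ * (γ t).re := by
      have : ∑ γ ∈ Spec, a γ * c γ * (2 - 2 * (γ t).re) =
          2 * P0 - 2 * ∑ γ ∈ Spec, a γ * c γ * (γ t).re := by
        rw [hP0, Finset.mul_sum, Finset.mul_sum, ← Finset.sum_sub_distrib]
        exact Finset.sum_congr rfl fun γ _ => by ring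
      linarith
    have h3 : -(ε / 4 * (N * l)) ≤
        ∑ γ ∈ Finset.univ.filter (fun γ => ¬ ε / 4 ≤ c γ), a γ * c γ * (γ t).re := by
      refine (neg_le_neg hoff).trans ?_
      rw [← Finset.sum_neg_distrib]
      refine Finset.sum_le_sum fun γ _ => ?_
      have h4 : -1 ≤ (γ t).re := by
        have := (abs_le.1 (Complex.abs_re_le_norm (γ t))).1
        rwa [AddChar.norm_apply γ t] at this
      have := mul_nonneg (a0 γ) (c0 γ)
      nlinarith
    have h5 : 0 < N * ∑ x, F x * F (x + t) := by
      rw [← hcorr, hsplit]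
      linarith
    have h6 : ∃ x, F x * F (x + t) ≠ 0 := by
      by_contra hcon
      push Not at hcon
      simp [hcon] at h5
    obtain ⟨x, hx⟩ := h6
    have h7 : ∀ y, F y ≠ 0 → ∃ l ∈ L, ∃ s ∈ S, y = l + s := by
      intro y hy
      obtain ⟨s, -, hs⟩ := Finset.exists_ne_zero_of_sum_ne_zero (show ∑ s, _ ≠ _ from hy)
      refine ⟨y - s, ?_, s, ?_, by abel⟩
      · by_contra hcon
        exact hs (by simp [hcon])
      · by_contra hcon
        exact hs (by simp [restrictProb, hcon])
    obtain ⟨l1, hl1, s1, hs1, e1⟩ := h7 _ (left_ne_zero_of_mul hx)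
    obtain ⟨l2, hl2, s2, hs2, e2⟩ := h7 _ (right_ne_zero_of_mul hx)
    have : t = l2 - l1 + s2 - s1 := by
      have : t = (x + t) - x := by abel
      rw [this, e2, e1]; abel
    rw [this]
    exact Set.sub_mem_sub (Set.add_mem_add (Set.sub_mem_sub hl2 hl1) hs2) hs1

lemma dCov_le {G : Type} [AddCommGroup G] {S T : Set G} {H : Type} [inst : AddCommGroup H]
    (φ : G →+ H) (U V : Set H) (X : Finset H) (h1 : S ⊆ φ ⁻¹' U) (h2 : φ ⁻¹' (V - V) ⊆ T)
    (h3 : U ⊆ (X : Set H) + V) : dCoveringNumber S T ≤ (X.card : ℕ∞) := by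
  unfold dCoveringNumber
  refine iInf_le_of_le H (iInf_le_of_le inst ?_)
  unfold dCovAux
  refine iInf_le_of_le φ (iInf_le_of_le U (iInf_le_of_le V (iInf_le_of_le h1
    (iInf_le_of_le h2 ?_))))
  exact sInf_le ⟨X, rfl, h3⟩

lemma dCov_exists {G : Type} [AddCommGroup G] {S T : Set G} {n : ℕ}
    (h : dCoveringNumber S T ≤ (n : ℕ∞)) :
    ∃ (H : Type) (_ : AddCommGroup H) (φ : G →+ H) (U V : Set H) (X : Finset H),
      S ⊆ φ ⁻¹' U ∧ φ ⁻¹' (V - V) ⊆ T ∧ U ⊆ (X : Set H) + V ∧ X.card ≤ n := by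
  have h' : dCoveringNumber S T < ((n + 1 : ℕ) : ℕ∞) :=
    h.trans_lt (by exact_mod_cast Nat.lt_succ_self n)
  unfold dCoveringNumber dCovAux coveringNumber at h'
  simp only [iInf_lt_iff, sInf_lt_iff] at h'
  obtain ⟨H, inst, φ, U, V, h1, h2, _, ⟨X, rfl, h3⟩, h4⟩ := h'
  exact ⟨H, inst, φ, U, V, X, h1, h2, h3, Nat.lt_succ_iff.1 (by exact_mod_cast h4)⟩

lemma dCov_mono {G : Type} [AddCommGroup G] {S S' T : Set G} (hS : S ⊆ S') {n : ℕ}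
    (h : dCoveringNumber S' T ≤ (n : ℕ∞)) : dCoveringNumber S T ≤ (n : ℕ∞) := by
  obtain ⟨H, inst, φ, U, V, X, h1, h2, h3, h4⟩ := dCov_exists h
  exact (dCov_le φ U V X (hS.trans h1) h2 h3).trans (by exact_mod_cast h4)

lemma dCov_inter {G : Type} [AddCommGroup G] {S T T' : Set G} {n n' : ℕ}
    (h : dCoveringNumber S T ≤ (n : ℕ∞)) (h' : dCoveringNumber S T' ≤ (n' : ℕ∞)) :
    dCoveringNumber S (T ∩ T') ≤ ((n * n' : ℕ) : ℕ∞) := by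
  obtain ⟨H, inst, φ, U, V, X, h1, h2, h3, h4⟩ := dCov_exists h
  obtain ⟨H', inst', φ', U', V', X', h1', h2', h3', h4'⟩ := dCov_exists h'
  have hc : (X ×ˢ X').card ≤ n * n' := by
    rw [Finset.card_product]; exact Nat.mul_le_mul h4 h4'
  refine (dCov_le (φ.prod φ') (U ×ˢ U') (V ×ˢ V') (X ×ˢ X') ?_ ?_ ?_).trans
    (by exact_mod_cast hc)
  · intro x hx
    exact ⟨h1 hx, h1' hx⟩
  · rintro x ⟨⟨a, a'⟩, ⟨ha, ha'⟩, ⟨b, b'⟩, ⟨hb, hb'⟩, e⟩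
    have e1 : a - b = φ x := congrArg Prod.fst e
    have e2 : a' - b' = φ' x := congrArg Prod.snd e
    exact ⟨h2 ⟨a, ha, b, hb, e1⟩, h2' ⟨a', ha', b', hb', e2⟩⟩
  · rintro ⟨u, u'⟩ ⟨hu, hu'⟩
    obtain ⟨x, hx, v, hv, e⟩ := h3 hu
    obtain ⟨x', hx', v', hv', e'⟩ := h3' hu'
    refine ⟨(x, x'), ?_, (v, v'), ⟨hv, hv'⟩, Prod.ext e e'⟩
    simp only [Finset.coe_product]
    exact ⟨hx, hx'⟩

lemma dCov_inter_many {G : Type} [AddCommGroup G] {S T : Set G} {ι : Type} (T' : ι → Set G)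
    {n N : ℕ} (h : dCoveringNumber S T ≤ (n : ℕ∞))
    (h' : ∀ i, dCoveringNumber S (T' i) ≤ (N : ℕ∞)) (s : Finset ι) :
    dCoveringNumber S (T ∩ {x | ∀ i ∈ s, x ∈ T' i}) ≤ ((n * N ^ s.card : ℕ) : ℕ∞) := by
  classical
  induction s using Finset.induction_on with
  | empty => simpa using h
  | insert a s ha ih =>
    have := dCov_inter ih (h' a)
    rw [Finset.card_insert_of_notMem ha, pow_succ, ← mul_assoc]
    convert this using 2
    ext x
    simp only [Set.mem_inter_iff, Set.mem_ofPred_eq, Finset.mem_insert, forall_eq_or_imp]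
    tauto

lemma dCov_finite {G : Type} [AddCommGroup G] [Fintype G] {S T : Set G} (h0 : (0 : G) ∈ T) :
    dCoveringNumber S T ≤ (Fintype.card G : ℕ∞) := by
  refine dCov_le (AddMonoidHom.id G) Set.univ {0} Finset.univ (fun _ _ => trivial) ?_ ?_
  · rintro x ⟨a, rfl, b, rfl, e⟩
    have : x = 0 := by simpa using e.symm
    exact this ▸ h0
  · intro x _
    exact ⟨x, by simp, 0, rfl, by simp⟩

lemma dCov_pos {G : Type} [AddCommGroup G] {S T : Set G} (hS : S.Nonempty) {n : ℕ}
    (h : dCoveringNumber S T ≤ (n : ℕ∞)) : 1 ≤ n := by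
  obtain ⟨H, inst, φ, U, V, X, h1, h2, h3, h4⟩ := dCov_exists h
  obtain ⟨x, hx⟩ := hS
  obtain ⟨y, hy, -⟩ := h3 (h1 hx)
  exact (Finset.card_pos.2 ⟨y, hy⟩).trans_le h4

lemma circNorm_exp_le (θ : ℝ) : circNorm (Complex.exp (θ * Complex.I)) ≤ |θ| / (2 * Real.pi) := by
  unfold circNorm
  refine div_le_div_of_nonneg_right ?_ (by positivity)
  by_cases h : |θ| < Real.pi
  · have := abs_lt.1 h
    rw [Complex.arg_exp_mul_I, (toIocMod_eq_self _).2]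
    constructor <;> linarith
  · exact (Complex.abs_arg_le_pi _).trans (not_lt.1 h)

lemma circ_sub {G : Type} [AddCommGroup G] [Fintype G] (γ : AddChar G ℂ) (u v : G) :
    circNorm (γ (u - v)) ≤ |(γ u).arg - (γ v).arg| / (2 * Real.pi) := by
  have h : ∀ w, γ w = Complex.exp ((γ w).arg * Complex.I) := by
    intro w
    have := Complex.norm_mul_exp_arg_mul_I (γ w)
    rw [AddChar.norm_apply γ w] at this
    simpa using this.symm
  have : γ (u - v) = Complex.exp (((γ u).arg - (γ v).arg : ℝ) * Complex.I) := by
    rw [AddChar.map_sub_eq_div]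
    conv_lhs => rw [h u, h v]
    rw [← Complex.exp_sub]
    push_cast; ring_nf
  rw [this]
  exact circNorm_exp_le _

lemma dCov_char {G : Type} [AddCommGroup G] [Fintype G] (γ : AddChar G ℂ) (R ρ : ℝ) (hρ : 0 < ρ)
    (K : ℕ) (hK : R ≤ K * ρ) :
    dCoveringNumber {x | circNorm (γ x) < R} {x | circNorm (γ x) < 2 * ρ} ≤ ((2 * K : ℕ) : ℕ∞) := by
  classical
  have hpi := Real.pi_pos
  set f : G → ℤ := fun x => ⌊(γ x).arg / (2 * Real.pi) / ρ⌋ with hf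
  have hex : ∀ k : ℤ, ∃ y : G, (∃ x, circNorm (γ x) < R ∧ f x = k) → f y = k := by
    intro k
    by_cases h : ∃ x, circNorm (γ x) < R ∧ f x = k
    · obtain ⟨x, -, hx⟩ := h
      exact ⟨x, fun _ => hx⟩
    · exact ⟨0, fun h' => absurd h' h⟩
  choose rep hrep using hex
  have hcard : ((Finset.Ico (-(K : ℤ)) K).image rep).card ≤ 2 * K := by
    refine Finset.card_image_le.trans ?_
    simp; omega
  refine (dCov_le (AddMonoidHom.id G) {x | circNorm (γ x) < R} {x | circNorm (γ x) < ρ}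
    ((Finset.Ico (-(K : ℤ)) K).image rep) (fun _ h => h) ?_ ?_).trans (by exact_mod_cast hcard)
  · rintro x ⟨a, ha, b, hb, e⟩
    have e' : a - b = x := e
    rw [← e']
    have h1 := circ_sub γ a b
    have h2 : |(γ a).arg - (γ b).arg| ≤ |(γ a).arg| + |(γ b).arg| := abs_sub _ _
    have h3 : |(γ a).arg - (γ b).arg| / (2 * Real.pi) ≤ circNorm (γ a) + circNorm (γ b) := by
      unfold circNorm; rw [← add_div]
      exact div_le_div_of_nonneg_right h2 (by positivity)
    have ha' : circNorm (γ a) < ρ := ha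
    have hb' : circNorm (γ b) < ρ := hb
    show circNorm (γ (a - b)) < 2 * ρ
    linarith
  · intro x hx
    have hx' : |(γ x).arg| / (2 * Real.pi) < R := hx
    have hfx : f x ∈ Finset.Ico (-(K : ℤ)) K := by
      have h1 : |(γ x).arg / (2 * Real.pi) / ρ| < K := by
        rw [abs_div, abs_div, abs_of_pos hρ, abs_of_pos (by positivity : 0 < 2 * Real.pi),
          div_lt_iff₀ hρ]
        linarith
      have h2 := abs_lt.1 h1
      rw [Finset.mem_Ico]
      constructor
      · exact Int.le_floor.2 (by push_cast; exact h2.1.le)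
      · exact Int.floor_lt.2 (by push_cast; exact h2.2)
    refine ⟨rep (f x), ?_, x - rep (f x), ?_, by simp⟩
    · rw [Finset.coe_image]; exact ⟨f x, hfx, rfl⟩
    · show circNorm (γ (x - rep (f x))) < ρ
      have h1 := hrep (f x) ⟨x, hx, rfl⟩
      have h2 := Int.abs_sub_lt_one_of_floor_eq_floor h1
      refine (circ_sub γ x (rep (f x))).trans_lt ?_
      rw [← sub_div, ← sub_div, abs_div, abs_div, abs_of_pos hρ,
        abs_of_pos (by positivity : 0 < 2 * Real.pi), div_lt_one hρ, abs_sub_comm] at h2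
      exact h2

/-- Adjoining characters to a Bohr system. -/
lemma exists_sub {G : Type} [AddCommGroup G] [Fintype G] (B : BohrSystem G) {m : ℕ}
    (Λ : Fin m → AddChar G ℂ) :
    ∃ B' : BohrSystem G, ∀ η, 0 < η → η ≤ 1 →
      B'.sets η = B.sets η ∩ {x | ∀ i ∈ Finset.univ, x ∈ {x | circNorm (Λ i x) < η * (1 / 100)}} := by
  classical
  obtain ⟨Γ, δ, h0, h1⟩ := B.exists_gen
  let δ' : AddChar G ℂ → ℝ := fun γ =>
    if γ ∈ Γ then (if γ ∈ Set.range Λ then min (δ γ) (1 / 100) else δ γ) else 1 / 100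
  refine ⟨⟨fun η => bohrSet (Γ ∪ Set.range Λ) fun γ => η * δ' γ, Γ ∪ Set.range Λ, δ', ?_,
    fun _ _ _ => rfl⟩, ?_⟩
  · intro γ _
    simp only [δ']
    split_ifs with h2 h3
    · exact lt_min (h0 γ h2) (by norm_num)
    · exact h0 γ h2
    · norm_num
  · intro η hη hη1
    rw [h1 η hη hη1]
    ext x
    simp only [bohrSet, Set.mem_ofPred_eq, Set.mem_inter_iff]
    constructor
    · intro h
      constructor
      · intro γ hγ
        have := h γ (Or.inl hγ)
        refine this.trans_le (mul_le_mul_of_nonneg_left ?_ hη.le)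
        simp only [δ', hγ, if_true]
        split_ifs
        · exact min_le_left _ _
        · exact le_rfl
      · intro i _
        have := h (Λ i) (Or.inr ⟨i, rfl⟩)
        refine this.trans_le (mul_le_mul_of_nonneg_left ?_ hη.le)
        simp only [δ', Set.mem_range_self, if_true]
        split_ifs
        · exact min_le_right _ _
        · exact le_rfl
    · rintro ⟨h2, h3⟩ γ hγ
      simp only [δ']
      split_ifs with h4 h5
      · rw [mul_min_of_nonneg _ _ hη.le]
        obtain ⟨i, rfl⟩ := h5
        exact lt_min (h2 _ h4) (h3 i (Finset.mem_univ _))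
      · exact h2 _ h4
      · obtain ⟨i, rfl⟩ := hγ.resolve_left h4
        exact h3 i (Finset.mem_univ _)

lemma zero_mem_bohr {G : Type} [AddCommGroup G] (B : BohrSystem G) {η : ℝ} (h : 0 < η)
    (h1 : η ≤ 1) : (0 : G) ∈ B.sets η := by
  obtain ⟨Γ, δ, h0, h2⟩ := B.exists_gen
  rw [h2 η h h1]
  intro γ hγ
  simpa [circNorm] using mul_pos h (h0 γ hγ)

lemma norm_le_of_circNorm {z : ℂ} (hz : ‖z‖ = 1) (h : circNorm z < 1 / 100) : ‖1 - z‖ ≤ 1 / 10 := by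
  have hpi := Real.pi_pos
  have e : z = Complex.exp (Complex.I * (z.arg : ℝ)) := by
    have := Complex.norm_mul_exp_arg_mul_I z
    rw [hz] at this
    rw [mul_comm]
    simpa using this.symm
  have h1 := Real.norm_exp_I_mul_ofReal_sub_one_le (x := z.arg)
  rw [← e, norm_sub_rev] at h1
  unfold circNorm at h
  rw [div_lt_iff₀ (by positivity)] at h
  rw [Real.norm_eq_abs] at h1
  have := Real.pi_lt_d2
  linarith

lemma params (ε α : ℝ) (hε : 0 < ε) (hε1 : ε ≤ 1) (hα : 0 < α) (hα1 : α ≤ 1) :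
    ∃ r m : ℕ, 2 ≤ r * ((1 / 1000) * (ε / 4)) ∧
      (9 / 10 : ℝ) ^ m < Real.exp (-(m / 20 : ℝ)) * ((α / 2) ^ r / 2) ^ 2 ∧
      (m : ℝ) ≤ 330000 * (ε⁻¹ ^ 2 * Real.log (2 * α⁻¹)) := by
  set l := Real.log (2 * α⁻¹) with hl
  have hi : 1 ≤ ε⁻¹ := (one_le_inv₀ hε).2 hε1
  have hia : 1 ≤ α⁻¹ := (one_le_inv₀ hα).2 hα1
  have hl2 : Real.log 2 ≤ l := Real.log_le_log (by norm_num) (by linarith)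
  have hlog2 := Real.log_two_gt_d9
  have hl0 : 1 / 2 ≤ l := by linarith
  refine ⟨⌈8000 * ε⁻¹⌉₊, ⌊40 * ((⌈8000 * ε⁻¹⌉₊ : ℝ) + 1) * l⌋₊ + 1, ?_, ?_, ?_⟩
  · have h := Nat.le_ceil (8000 * ε⁻¹)
    have h2 : 8000 * ε⁻¹ * ((1 / 1000) * (ε / 4)) = 2 := by field_simp; norm_num
    rw [← h2]
    exact mul_le_mul_of_nonneg_right h (by positivity)
  · set r := ⌈8000 * ε⁻¹⌉₊
    set m := ⌊40 * ((r : ℝ) + 1) * l⌋₊ + 1 with hm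
    have hm1 : 40 * ((r : ℝ) + 1) * l < m := by
      rw [hm]; push_cast; exact Nat.lt_floor_add_one _
    have e1 : (9 / 10 : ℝ) ^ m ≤ Real.exp (-(m / 10 : ℝ)) := by
      have h1 : (9 / 10 : ℝ) ≤ Real.exp (-(1 / 10)) := by
        have := Real.add_one_le_exp (-(1 / 10) : ℝ); linarith
      refine (pow_le_pow_left₀ (by norm_num) h1 m).trans (le_of_eq ?_)
      rw [← Real.exp_nat_mul]; congr 1; ring
    have e2 : α / 2 = Real.exp (-l) := by
      rw [Real.exp_neg, hl, Real.exp_log (by positivity)]; field_simp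
    have e3 : ((α / 2) ^ r / 2) ^ 2 = Real.exp (-(2 * (r * l + Real.log 2))) := by
      rw [e2, ← Real.exp_nat_mul, show (2 : ℝ) = Real.exp (Real.log 2) from
        (Real.exp_log (by norm_num)).symm, ← Real.exp_sub, ← Real.exp_nat_mul]
      rw [Real.exp_log (by norm_num)]
      congr 1; push_cast; ring
    rw [e3, ← Real.exp_add]
    refine e1.trans_lt (Real.exp_lt_exp.2 ?_)
    linarith
  · have h := Nat.ceil_lt_add_one (show 0 ≤ 8000 * ε⁻¹ by positivity)
    set r := ⌈8000 * ε⁻¹⌉₊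
    push_cast
    have h1 := Nat.floor_le (show 0 ≤ 40 * ((r : ℝ) + 1) * l by positivity)
    have h2 : (r : ℝ) + 1 ≤ 8002 * ε⁻¹ := by linarith
    have h3 : 40 * ((r : ℝ) + 1) * l ≤ 40 * (8002 * ε⁻¹) * l := by gcongr
    have h4 : ε⁻¹ ≤ ε⁻¹ ^ 2 := by nlinarith
    have h5 : 1 ≤ 2 * (ε⁻¹ ^ 2 * l) := by nlinarith
    have h6 : ε⁻¹ * l ≤ ε⁻¹ ^ 2 * l := by gcongr
    linarith

lemma dCov_toNat {G : Type} [AddCommGroup G] [Fintype G] {S T : Set G} (h0 : (0 : G) ∈ T) :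
    dCoveringNumber S T = ((dCoveringNumber S T).toNat : ℕ∞) := by
  refine (ENat.coe_toNat ?_).symm
  intro h
  have := dCov_finite (S := S) h0
  rw [h] at this
  exact absurd this (by simp)

lemma cov_bound {G : Type} [AddCommGroup G] [Fintype G] (A : Set G) (B B' : BohrSystem G) {m : ℕ}
    (Λ : Fin m → AddChar G ℂ)
    (h : ∀ η, 0 < η → η ≤ 1 →
      B'.sets η = B.sets η ∩
        {x | ∀ i ∈ Finset.univ, x ∈ {x | circNorm (Λ i x) < η * (1 / 100)}}) :
    dCoveringNumber A (B'.sets 1) ≤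
      (((dCoveringNumber A (B.sets 1)).toNat * 400 ^ m : ℕ) : ℕ∞) := by
  have h0 : (0 : G) ∈ B.sets 1 := zero_mem_bohr B one_pos le_rfl
  rw [h 1 one_pos le_rfl]
  have := dCov_inter_many (S := A) (T := B.sets 1)
    (fun i => {x | circNorm (Λ i x) < 1 * (1 / 100)}) (N := 400) (dCov_toNat h0).le ?_ Finset.univ
  · simpa using this
  · intro i
    have h1 := dCov_char (Λ i) 1 (1 / 200) (by norm_num) 200 (by norm_num)
    have h2 : A ⊆ {x | circNorm (Λ i x) < 1} := by
      intro x _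
      show |_| / _ < (1 : ℝ)
      rw [div_lt_one (by positivity)]
      have := Complex.abs_arg_le_pi (Λ i x)
      have := Real.pi_pos
      linarith
    have h3 := dCov_mono h2 h1
    norm_num at h3 ⊢
    exact h3

lemma dim_bound {G : Type} [AddCommGroup G] [Fintype G] (B B' : BohrSystem G) {m : ℕ}
    (Λ : Fin m → AddChar G ℂ)
    (h : ∀ η, 0 < η → η ≤ 1 →
      B'.sets η = B.sets η ∩
        {x | ∀ i ∈ Finset.univ, x ∈ {x | circNorm (Λ i x) < η * (1 / 100)}}) :
    B'.dim ≤ B.dim + 3 * m := by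
  unfold BohrSystem.dim
  have hle : ∀ {a b : ℕ}, 1 ≤ a → a ≤ b → Real.logb 2 a ≤ Real.logb 2 b := by
    intro a b ha hab
    exact Real.logb_le_logb_of_le (by norm_num) (by exact_mod_cast ha) (by exact_mod_cast hab)
  refine csSup_le ⟨_, 1, one_pos, le_rfl, rfl⟩ ?_
  rintro _ ⟨η, hη, hη1, rfl⟩
  have hη2 : 0 < η / 2 := by linarith
  have hη3 : η / 2 ≤ 1 := by linarith
  have z1 := zero_mem_bohr B hη hη1
  have z2 := zero_mem_bohr B hη2 hη3
  have z1' := zero_mem_bohr B' hη hη1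
  have z2' := zero_mem_bohr B' hη2 hη3
  set d := (dCoveringNumber (B.sets η) (B.sets (η / 2))).toNat with hd
  have hd1 : dCoveringNumber (B.sets η) (B.sets (η / 2)) = (d : ℕ∞) := dCov_toNat z2
  have hdpos : 1 ≤ d := dCov_pos ⟨0, z1⟩ hd1.le
  have hdim : Real.logb 2 d ≤ dimOfSets B.sets := by
    refine le_csSup ⟨Real.logb 2 (Fintype.card G), ?_⟩ ⟨η, hη, hη1, rfl⟩
    rintro _ ⟨ξ, hξ, hξ1, rfl⟩
    have w2 := zero_mem_bohr B (show 0 < ξ / 2 by linarith) (by linarith)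
    have w1 := zero_mem_bohr B hξ hξ1
    have e := dCov_toNat (S := B.sets ξ) w2
    have f := dCov_finite (S := B.sets ξ) w2
    rw [e] at f
    exact hle (dCov_pos ⟨0, w1⟩ e.le) (by exact_mod_cast f)
  have hmain : dCoveringNumber (B'.sets η) (B'.sets (η / 2)) ≤ ((d * 8 ^ m : ℕ) : ℕ∞) := by
    have hsub : B'.sets η ⊆ B.sets η := by rw [h η hη hη1]; exact Set.inter_subset_left
    have := dCov_inter_many (S := B'.sets η) (T := B.sets (η / 2))
      (fun i => {x | circNorm (Λ i x) < η / 2 * (1 / 100)}) (N := 8) (dCov_mono hsub hd1.le) ?_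
      Finset.univ
    · rw [h (η / 2) hη2 hη3]
      simpa using this
    · intro i
      have h1 := dCov_char (Λ i) (η * (1 / 100)) (η / 400) (by linarith) 4
        (by push_cast; linarith)
      have h2 : B'.sets η ⊆ {x | circNorm (Λ i x) < η * (1 / 100)} := by
        rw [h η hη hη1]
        intro x hx
        exact hx.2 i (Finset.mem_univ _)
      have h3 := dCov_mono h2 h1
      rw [show 2 * (η / 400) = η / 2 * (1 / 100) by ring] at h3
      exact h3
  have e' := dCov_toNat (S := B'.sets η) z2'
  have hmain' := hmain
  rw [e'] at hmain'
  have h5 := hle (dCov_pos ⟨0, z1'⟩ e'.le) (show _ ≤ d * 8 ^ m by exact_mod_cast hmain')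
  have h6 : Real.logb 2 ((d * 8 ^ m : ℕ) : ℝ) = Real.logb 2 d + 3 * m := by
    have hd0 : (d : ℝ) ≠ 0 := by exact_mod_cast (by omega : d ≠ 0)
    push_cast
    rw [Real.logb_mul hd0 (by positivity), Real.logb_pow,
      show (8 : ℝ) = 2 ^ (3 : ℕ) by norm_num, Real.logb_pow, Real.logb_self_eq_one (by norm_num)]
    push_cast; ring
  rw [h6] at h5
  unfold enatReal
  linarith

/-- Lemma 5.4, Bogolioùboff–Chang. -/
theorem statement7 :
    ∃ C : ℝ, 0 < C ∧
      ∀ (G : Type) [AddCommGroup G] [Fintype G],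
        ∀ (A : Set G) (B : BohrSystem G) (μ : G → ℝ) (S L : Set G) (ε : ℝ),
          A.Nonempty → IsProb μ → ApproxInvariant B.sets μ → S ⊆ B.sets 1 →
          0 < wMeasure μ S → 0 < ε → ε ≤ 1 → L.Nonempty →
          ε * haar L ≤
            (Fintype.card G : ℝ)⁻¹ *
              ∑ x : G, convR (L.indicator (1 : G → ℝ)) (restrictProb μ S) x ^ 2 →
          ∃ B' : BohrSystem G, B'.le B ∧
            ((dCoveringNumber A (B'.sets 1) : ℝ≥0∞) ≤
              ENNReal.ofReal ((2 * ε⁻¹) ^ (C * ε⁻¹ ^ 2 * Real.log (2 * (wMeasure μ S)⁻¹))) *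
                (dCoveringNumber A (B.sets 1) : ℝ≥0∞)) ∧
            B'.dim ≤ B.dim + C * ε⁻¹ ^ 2 * Real.log (2 * (wMeasure μ S)⁻¹) ∧
            B'.sets 1 ⊆ L - L + S - S := by
  refine ⟨2970000, by norm_num, ?_⟩
  intro G _ _ A B μ S L ε hA hμ hinv hSB hS hε hε1 hL h
  have hα1 : wMeasure μ S ≤ 1 := by
    rw [← hμ.2]
    exact Finset.sum_le_sum fun x _ => Set.indicator_le_self' (fun _ _ => hμ.1 _) x
  obtain ⟨r, m, hr, hm, hmC⟩ := params ε (wMeasure μ S) hε hε1 hS hα1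
  obtain ⟨p, hp0, hp1, hp, hfin⟩ := fourier_part μ S L hL ε hε h
  obtain ⟨wp, _, hwp, -, hw⟩ := hinv 1 one_pos le_rfl
  obtain ⟨Λ, hΛ⟩ := select μ wp hwp hμ.1 S (B.sets 1) hS
    (fun x hx y => by have := (hw x hx y).2; linarith) (ε / 4) (by linarith) p hp0 hp1 hp r m hr hm
  obtain ⟨B', hB'⟩ := exists_sub B Λ
  refine ⟨B', ?_, ?_, ?_, ?_⟩
  · intro η h1 h2
    rw [hB' η h1 h2]
    exact Set.inter_subset_left
  · have h1 := cov_bound A B B' Λ hB'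
    have h0 : (0 : G) ∈ B.sets 1 := zero_mem_bohr B one_pos le_rfl
    have h2 : ((dCoveringNumber A (B'.sets 1) : ℕ∞) : ℝ≥0∞) ≤
        (((dCoveringNumber A (B.sets 1)).toNat * 400 ^ m : ℕ) : ℝ≥0∞) := by
      have := ENat.toENNReal_le.2 h1
      simpa using this
    refine h2.trans ?_
    rw [dCov_toNat (S := A) h0]
    simp only [ENat.toNat_coe, ENat.toENNReal_coe]
    rw [Nat.cast_mul, mul_comm]
    refine mul_le_mul_left ?_ _
    rw [← ENNReal.ofReal_natCast]
    refine ENNReal.ofReal_le_ofReal ?_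
    have hi : 1 ≤ ε⁻¹ := (one_le_inv₀ hε).2 hε1
    calc ((400 ^ m : ℕ) : ℝ) ≤ (2 : ℝ) ^ (9 * m) := by
          rw [pow_mul]; push_cast
          exact pow_le_pow_left₀ (by norm_num) (by norm_num) m
      _ ≤ (2 * ε⁻¹) ^ (9 * m) := pow_le_pow_left₀ (by norm_num) (by linarith) _
      _ = (2 * ε⁻¹) ^ ((9 * m : ℕ) : ℝ) := (Real.rpow_natCast _ _).symm
      _ ≤ _ := by
          refine Real.rpow_le_rpow_of_exponent_le (by linarith) ?_
          push_cast
          linarith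
  · have h1 := dim_bound B B' Λ hB'
    have : (0 : ℝ) ≤ m := Nat.cast_nonneg _
    linarith
  · intro t ht
    rw [hB' 1 one_pos le_rfl] at ht
    refine hfin t (hΛ t ht.1 fun i => ?_)
    refine norm_le_of_circNorm (AddChar.norm_apply _ _) ?_
    have : circNorm (Λ i t) < 1 * (1 / 100) := ht.2 i (Finset.mem_univ _)
    linarith

end Paper
end
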